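/- arXiv:2509.11494 — 4 statements merged into one kernel-verified Lean document; each statement's English description precedes it below -/
import Mathlib

section
/- For all n ≥ 0, the number of permutations π of [n] avoiding 123 such that both π and π⁻¹ are Jacobi equals the secondary structure number s_n, defined by s₀ = 1 and s_{n+1} = s_n + Σ_{k=1}^{n−1} s_k · s_{n−1−k} for all n ≥ 0. -/
/-- The length of `ρ_π(π_k)`: the maximal consecutive subword of `π` immediately to the
right of position `k`, all of whose letters are larger than `π_k`.  Letters of a
permutation of `[n] = {1,…,n}` are modelled by `(π i : ℕ) + 1` for `π : Equiv.Perm (Fin n)`. -/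
noncomputable def rhoLen {n : ℕ} (π : Equiv.Perm (Fin n)) (k : Fin n) : ℕ :=
  Nat.card {j : Fin n // k < j ∧ ∀ i : Fin n, k < i → i ≤ j → π k < π i}

/-- A permutation is Jacobi if `ρ_π(π_k)` has even length for every position `k`. -/
def IsJacobi {n : ℕ} (π : Equiv.Perm (Fin n)) : Prop :=
  ∀ k : Fin n, Even (rhoLen π k)

/-- `π` avoids the pattern `123`. -/
def Avoids123 {n : ℕ} (π : Equiv.Perm (Fin n)) : Prop :=
  ¬ ∃ i j k : Fin n, i < j ∧ j < k ∧ π i < π j ∧ π j < π k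

/-- `π` avoids the pattern `132`. -/
def Avoids132 {n : ℕ} (π : Equiv.Perm (Fin n)) : Prop :=
  ¬ ∃ i j k : Fin n, i < j ∧ j < k ∧ π i < π k ∧ π k < π j

/-- `π` avoids the pattern `213`. -/
def Avoids213 {n : ℕ} (π : Equiv.Perm (Fin n)) : Prop :=
  ¬ ∃ i j k : Fin n, i < j ∧ j < k ∧ π j < π i ∧ π i < π k

/-- `π` avoids the pattern `231`. -/
def Avoids231 {n : ℕ} (π : Equiv.Perm (Fin n)) : Prop :=
  ¬ ∃ i j k : Fin n, i < j ∧ j < k ∧ π k < π i ∧ π i < π j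

/-- `π` avoids the pattern `312`. -/
def Avoids312 {n : ℕ} (π : Equiv.Perm (Fin n)) : Prop :=
  ¬ ∃ i j k : Fin n, i < j ∧ j < k ∧ π j < π k ∧ π k < π i

/-- `π` avoids the pattern `321`. -/
def Avoids321 {n : ℕ} (π : Equiv.Perm (Fin n)) : Prop :=
  ¬ ∃ i j k : Fin n, i < j ∧ j < k ∧ π k < π j ∧ π j < π i

namespace JacobiAux

/-- Number of indices satisfying a predicate. -/
noncomputable def cnt {n : ℕ} (P : Fin n → Prop) : ℕ := Nat.card {j : Fin n // P j}

lemma cnt_congr {n : ℕ} {P Q : Fin n → Prop} (h : ∀ j, P j ↔ Q j) : cnt P = cnt Q := by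
  have : P = Q := funext fun j => propext (h j)
  rw [this]

open Classical in
lemma cnt_eq_sum {n : ℕ} (P : Fin n → Prop) : cnt P = ∑ j, if P j then 1 else 0 := by
  unfold cnt
  rw [Nat.card_eq_fintype_card, Fintype.card_subtype, Finset.card_filter]

open Classical in
lemma cnt_succAbove {n : ℕ} (x : Fin (n + 1)) (P : Fin (n + 1) → Prop) :
    cnt P = (if P x then 1 else 0) + cnt (fun y => P (x.succAbove y)) := by
  rw [cnt_eq_sum, cnt_eq_sum, Fin.sum_univ_succAbove _ x]

lemma cnt_false {n : ℕ} {P : Fin n → Prop} (h : ∀ j, ¬ P j) : cnt P = 0 := by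
  unfold cnt
  have : IsEmpty {j : Fin n // P j} := ⟨fun j => h j.1 j.2⟩
  exact Nat.card_of_isEmpty

/-- Prepend the letter `x` to the word `τ`. -/
def pcons {r : ℕ} (x : Fin (r + 1)) (τ : Equiv.Perm (Fin r)) : Equiv.Perm (Fin (r + 1)) :=
  ((finSuccEquiv' 0).trans (Equiv.optionCongr τ)).trans (finSuccEquiv' x).symm

@[simp] lemma pcons_zero {r : ℕ} (x : Fin (r + 1)) (τ : Equiv.Perm (Fin r)) :
    pcons x τ 0 = x := by
  simp [pcons]

@[simp] lemma pcons_succ {r : ℕ} (x : Fin (r + 1)) (τ : Equiv.Perm (Fin r)) (i : Fin r) :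
    pcons x τ i.succ = x.succAbove (τ i) := by
  have : i.succ = (0 : Fin (r + 1)).succAbove i := by simp
  rw [this]
  simp only [pcons, Equiv.trans_apply, finSuccEquiv'_succAbove]
  simp

@[simp] lemma pcons_inv_self {r : ℕ} (x : Fin (r + 1)) (τ : Equiv.Perm (Fin r)) :
    (pcons x τ)⁻¹ x = 0 := by
  rw [Equiv.Perm.inv_eq_iff_eq]; simp

@[simp] lemma pcons_inv_succAbove {r : ℕ} (x : Fin (r + 1)) (τ : Equiv.Perm (Fin r))
    (y : Fin r) : (pcons x τ)⁻¹ (x.succAbove y) = (τ⁻¹ y).succ := by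
  rw [Equiv.Perm.inv_eq_iff_eq]; simp

lemma pcons_bij (r : ℕ) : Function.Bijective
    (fun p : Fin (r + 1) × Equiv.Perm (Fin r) => pcons p.1 p.2) := by
  rw [Fintype.bijective_iff_injective_and_card]
  constructor
  · rintro ⟨x, τ⟩ ⟨y, σ⟩ h
    have hx : x = y := by simpa using congrArg (fun e => e 0) h
    subst hx
    have : τ = σ := by
      ext i
      have := congrArg (fun e => e i.succ) h
      simp at this
      rw [this]
    rw [this]
  · simp [Fintype.card_perm, Nat.factorial_succ]

lemma card_pcons (r : ℕ) (P : Equiv.Perm (Fin (r + 1)) → Prop) :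
    Nat.card {π // P π} = ∑ x : Fin (r + 1), Nat.card {τ // P (pcons x τ)} := by
  rw [← Nat.card_sigma]
  symm
  let e := Equiv.ofBijective _ (pcons_bij r)
  refine Nat.card_congr ?_
  refine Equiv.trans ?_ (Equiv.subtypeEquiv e (p := fun p => P (pcons p.1 p.2)) ?_)
  · exact ⟨fun a => ⟨(a.1, a.2.1), a.2.2⟩, fun a => ⟨a.1.1, a.1.2, a.2⟩,
      fun _ => rfl, fun _ => rfl⟩
  · intro a; rfl

/-- Avoidance of `123` by the word `τ` preceded by a virtual letter just below the value `v`. -/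
def Av {r : ℕ} (v : ℕ) (τ : Equiv.Perm (Fin r)) : Prop :=
  Avoids123 τ ∧ ∀ i j : Fin r, i < j → v ≤ (τ i : ℕ) → ¬ τ i < τ j

/-- Length of the initial run of letters that are at least `v`. -/
noncomputable def run {r : ℕ} (v : ℕ) (τ : Equiv.Perm (Fin r)) : ℕ :=
  cnt (fun j => ∀ i, i ≤ j → v ≤ (τ i : ℕ))

/-- The condition on the inverse, relative to the threshold `v`. -/
def InvJ {r : ℕ} (v : ℕ) (τ : Equiv.Perm (Fin r)) : Prop :=
  ∀ y : Fin r, (y : ℕ) < v →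
    Even (cnt (fun j : Fin r => y < j ∧ (j : ℕ) < v ∧ ∀ i, y < i → i ≤ j → τ⁻¹ y < τ⁻¹ i))

lemma sa_val {r : ℕ} (x : Fin (r + 1)) (y : Fin r) :
    ((x.succAbove y : Fin (r + 1)) : ℕ) = if (y : ℕ) < x then (y : ℕ) else y + 1 := by
  simp only [Fin.succAbove, Fin.lt_def, Fin.val_castSucc]
  split_ifs <;> simp

lemma jacobi_pcons {r : ℕ} (x : Fin (r + 1)) (τ : Equiv.Perm (Fin r)) :
    IsJacobi (pcons x τ) ↔ Even (run x τ) ∧ IsJacobi τ := by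
  unfold IsJacobi
  rw [Fin.forall_fin_succ]
  refine and_congr ?_ (forall_congr' fun k => ?_)
  · have : rhoLen (pcons x τ) 0 = run x τ := by
      change cnt _ = cnt _
      rw [cnt_succAbove 0]
      simp only [lt_irrefl, false_and, if_false, zero_add]
      refine cnt_congr fun j => ?_
      rw [Fin.forall_fin_succ]
      simp only [Fin.zero_succAbove, Fin.succ_pos, pcons_zero, pcons_succ, lt_irrefl,
        Fin.succ_le_succ_iff, true_and, false_imp_iff, true_imp_iff]
      refine forall_congr' fun i => imp_congr_right fun _ => ?_
      rw [Fin.lt_def, sa_val]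
      split_ifs <;> omega
    rw [this]
  · have : rhoLen (pcons x τ) k.succ = rhoLen τ k := by
      change cnt _ = cnt _
      rw [cnt_succAbove 0]
      simp only [Fin.not_lt_zero, false_and, if_false, zero_add]
      refine cnt_congr fun j => ?_
      rw [Fin.forall_fin_succ]
      simp only [Fin.zero_succAbove, pcons_zero, pcons_succ,
        Fin.succ_le_succ_iff, Fin.succ_lt_succ_iff, Fin.not_lt_zero, true_and, false_imp_iff,
        Fin.succAbove_lt_succAbove_iff]
    rw [this]

lemma run_pcons_lt {r v : ℕ} (x : Fin (r + 1)) (τ : Equiv.Perm (Fin r)) (h : (x : ℕ) < v) :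
    run v (pcons x τ) = 0 := by
  refine cnt_false fun j hj => ?_
  have := hj 0 (Fin.zero_le _)
  simp at this; omega

lemma run_pcons_last {r v : ℕ} (τ : Equiv.Perm (Fin r)) (h : v ≤ r) :
    run v (pcons (Fin.last r) τ) = 1 + run v τ := by
  unfold run
  rw [cnt_succAbove 0, if_pos]
  · congr 1
    refine cnt_congr fun j => ?_
    rw [Fin.forall_fin_succ]
    simp [h]
  · intro i hi
    have : i = 0 := by simpa using hi
    subst this; simpa using h

lemma run_last {r : ℕ} (τ : Equiv.Perm (Fin r)) : run r τ = 0 := by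
  refine cnt_false fun j hj => ?_
  have := hj j le_rfl
  have := (τ j).2
  omega

lemma av_pcons_lt {r v : ℕ} (x : Fin (r + 1)) (τ : Equiv.Perm (Fin r)) (h : (x : ℕ) < v) :
    Av v (pcons x τ) ↔ Av x τ := by
  unfold Av Avoids123
  constructor
  · rintro ⟨h1, h2⟩
    refine ⟨?_, ?_⟩
    · rintro ⟨i, j, k, hij, hjk, a, b⟩
      exact h1 ⟨i.succ, j.succ, k.succ, by simpa, by simpa, by simpa, by simpa⟩
    · intro i j hij hx hlt
      refine h1 ⟨0, i.succ, j.succ, by simp, by simpa, ?_, by simpa⟩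
      rw [pcons_zero, pcons_succ, Fin.lt_def, sa_val]
      split_ifs <;> omega
  · rintro ⟨h1, h2⟩
    refine ⟨?_, ?_⟩
    · rintro ⟨i, j, k, hij, hjk, a, b⟩
      obtain ⟨j, rfl⟩ := Fin.exists_succ_eq.2 (Fin.ne_zero_of_lt hij)
      obtain ⟨k, rfl⟩ := Fin.exists_succ_eq.2 (Fin.ne_zero_of_lt hjk)
      simp only [pcons_succ, Fin.succAbove_lt_succAbove_iff, Fin.succ_lt_succ_iff] at b hjk
      rcases Fin.eq_zero_or_eq_succ i with rfl | ⟨i, rfl⟩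
      · refine h2 j k hjk ?_ b
        rw [pcons_zero, pcons_succ, Fin.lt_def, sa_val] at a
        split_ifs at a <;> omega
      · exact h1 ⟨i, j, k, by simpa using hij, hjk, by simpa using a, b⟩
    · intro i j hij hv hlt
      obtain ⟨j, rfl⟩ := Fin.exists_succ_eq.2 (Fin.ne_zero_of_lt hij)
      rcases Fin.eq_zero_or_eq_succ i with rfl | ⟨i, rfl⟩
      · simp at hv; omega
      · refine h2 i j (by simpa using hij) ?_ (by simpa using hlt)
        rw [pcons_succ, sa_val] at hv
        split_ifs at hv <;> omega

lemma av_pcons_last {r v : ℕ} (τ : Equiv.Perm (Fin r)) :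
    Av v (pcons (Fin.last r) τ) ↔ Av v τ := by
  unfold Av Avoids123
  constructor
  · rintro ⟨h1, h2⟩
    refine ⟨?_, ?_⟩
    · rintro ⟨i, j, k, hij, hjk, a, b⟩
      exact h1 ⟨i.succ, j.succ, k.succ, by simpa, by simpa, by simpa, by simpa⟩
    · intro i j hij hx hlt
      exact h2 i.succ j.succ (by simpa) (by simpa) (by simpa)
  · rintro ⟨h1, h2⟩
    have key : ∀ j, ¬ pcons (Fin.last r) τ 0 < j := by
      intro j; simp [Fin.le_last]
    refine ⟨?_, ?_⟩
    · rintro ⟨i, j, k, hij, hjk, a, b⟩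
      obtain ⟨j, rfl⟩ := Fin.exists_succ_eq.2 (Fin.ne_zero_of_lt hij)
      obtain ⟨k, rfl⟩ := Fin.exists_succ_eq.2 (Fin.ne_zero_of_lt hjk)
      rcases Fin.eq_zero_or_eq_succ i with rfl | ⟨i, rfl⟩
      · exact key _ a
      · exact h1 ⟨i, j, k, by simpa using hij, by simpa using hjk, by simpa using a,
          by simpa using b⟩
    · intro i j hij hv hlt
      obtain ⟨j, rfl⟩ := Fin.exists_succ_eq.2 (Fin.ne_zero_of_lt hij)
      rcases Fin.eq_zero_or_eq_succ i with rfl | ⟨i, rfl⟩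
      · exact key _ hlt
      · exact h2 i j (by simpa using hij) (by simpa using hv) (by simpa using hlt)

lemma av_pcons_ge {r v : ℕ} (x : Fin (r + 1)) (τ : Equiv.Perm (Fin r)) (h : v ≤ (x : ℕ))
    (ha : Av v (pcons x τ)) : x = Fin.last r := by
  by_contra hne
  have hlt : x < Fin.last r := lt_of_le_of_ne (Fin.le_last _) hne
  obtain ⟨j, hj⟩ := (pcons x τ).surjective (Fin.last r)
  refine ha.2 0 j ?_ (by simpa) (by simpa [hj])
  rw [Fin.pos_iff_ne_zero]
  rintro rfl
  simp at hj
  exact hne hj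

lemma invJ_pcons_last {r v : ℕ} (τ : Equiv.Perm (Fin r)) (h : v ≤ r) :
    InvJ v (pcons (Fin.last r) τ) ↔ InvJ v τ := by
  unfold InvJ
  rw [Fin.forall_iff_succAbove (Fin.last r)]
  rw [and_iff_right (by intro h'; simp at h'; omega)]
  refine forall_congr' fun y => ?_
  simp only [Fin.succAbove_last, Fin.val_castSucc]
  refine imp_congr_right fun hy => ?_
  rw [cnt_succAbove (Fin.last r), if_neg (by rintro ⟨-, h', -⟩; simp at h'; omega), zero_add]
  refine iff_of_eq (congrArg _ (cnt_congr fun j => ?_))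
  rw [Fin.forall_iff_succAbove (Fin.last r)]
  rw [pcons_inv_self]
  have e : ∀ z : Fin r, (pcons (Fin.last r) τ)⁻¹ z.castSucc = (τ⁻¹ z).succ := by
    intro z; rw [← pcons_inv_succAbove (Fin.last r), Fin.succAbove_last]
  simp only [e, Fin.succAbove_last, Fin.castSucc_lt_castSucc_iff, Fin.castSucc_le_castSucc_iff,
    Fin.succ_lt_succ_iff, Fin.val_castSucc]
  have : ¬ Fin.last r ≤ j.castSucc := not_le.2 (Fin.castSucc_lt_last j)
  simp only [this, false_imp_iff, imp_true_iff, true_and]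

lemma cnt_between {r v : ℕ} (x : Fin r) (h : (x : ℕ) < v) (hv : v ≤ r) :
    cnt (fun j : Fin r => x < j ∧ (j : ℕ) < v) = v - 1 - x := by
  unfold cnt
  have e : {j : Fin r // x < j ∧ (j : ℕ) < v} ≃ {a : ℕ // a ∈ Finset.Ioo (x : ℕ) v} :=
    ⟨fun j => ⟨j.1.1, Finset.mem_Ioo.2 ⟨j.2.1, j.2.2⟩⟩,
      fun j => ⟨⟨j.1, lt_of_lt_of_le (Finset.mem_Ioo.1 j.2).2 hv⟩, (Finset.mem_Ioo.1 j.2).1,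
        (Finset.mem_Ioo.1 j.2).2⟩, fun _ => rfl, fun _ => rfl⟩
  rw [Nat.card_congr e, Nat.card_eq_fintype_card, Fintype.card_coe, Nat.card_Ioo]
  omega

lemma invJ_pcons_lt {r v : ℕ} (x : Fin (r + 1)) (τ : Equiv.Perm (Fin r)) (h : (x : ℕ) < v)
    (hv : v ≤ r + 1) (ha : Av x τ) :
    InvJ v (pcons x τ) ↔ Odd (v - x) ∧ InvJ x τ := by
  unfold InvJ
  rw [Fin.forall_iff_succAbove x]
  refine and_congr ?_ (forall_congr' fun y => ?_)
  · rw [imp_iff_right h]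
    have : cnt (fun j : Fin (r + 1) => x < j ∧ (j : ℕ) < v ∧
        ∀ i, x < i → i ≤ j → (pcons x τ)⁻¹ x < (pcons x τ)⁻¹ i) = v - 1 - x := by
      rw [← cnt_between x h hv]
      refine cnt_congr fun j => ?_
      refine and_congr_right fun hj => and_iff_left ?_
      intro i hi _
      rw [pcons_inv_self, Fin.pos_iff_ne_zero, Ne, Equiv.Perm.inv_eq_iff_eq, pcons_zero]
      exact hi.ne'
    rw [this, Nat.even_iff, Nat.odd_iff]
    omega
  · rw [cnt_succAbove x, if_neg, zero_add]
    · by_cases hy : (y : ℕ) < x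
      · have hyv : ((x.succAbove y : Fin (r + 1)) : ℕ) < v := by
          rw [sa_val, if_pos hy]; omega
        rw [imp_iff_right hy, imp_iff_right hyv]
        refine iff_of_eq (congrArg _ (cnt_congr fun j => ?_))
        simp only [Fin.forall_iff_succAbove x, pcons_inv_self, pcons_inv_succAbove,
          Fin.succAbove_lt_succAbove_iff, Fin.succAbove_le_succAbove_iff, Fin.succ_lt_succ_iff,
          Fin.not_lt_zero]
        refine and_congr_right fun hj => ?_
        rw [← and_assoc]
        refine and_congr_left fun _ => ?_
        rw [sa_val, Fin.lt_def, Fin.le_def, sa_val, sa_val]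
        simp only [hy, if_true]
        split_ifs <;> simp <;> omega
      · refine iff_of_true (fun _ => ?_) (fun h' => absurd h' hy)
        rw [cnt_false]
        · simp
        · rintro j ⟨h1, h2, h3⟩
          have := h3 _ h1 le_rfl
          simp only [pcons_inv_succAbove, Fin.succ_lt_succ_iff, 
            Fin.succAbove_lt_succAbove_iff] at this h1
          refine ha.2 _ _ this ?_ ?_
          · simpa using hy
          · simpa using h1
    · rintro ⟨h1, h2, h3⟩
      have := h3 _ h1 le_rfl
      simp at this

/-- The state predicate. -/
def Q {r : ℕ} (v b : ℕ) (τ : Equiv.Perm (Fin r)) : Prop :=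
  Av v τ ∧ IsJacobi τ ∧ run v τ % 2 = b ∧ InvJ v τ

lemma Q_lt {r v b : ℕ} (x : Fin (r + 1)) (τ : Equiv.Perm (Fin r)) (h : (x : ℕ) < v)
    (hv : v ≤ r + 1) : Q v b (pcons x τ) ↔ (b = 0 ∧ Odd (v - x)) ∧ Q x 0 τ := by
  unfold Q
  rw [av_pcons_lt x τ h, jacobi_pcons, run_pcons_lt x τ h, Nat.even_iff]
  by_cases ha : Av x τ
  · rw [invJ_pcons_lt x τ h hv ha]
    have : 0 % 2 = b ↔ b = 0 := by omega
    rw [this]; tauto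
  · tauto

lemma Q_ge {r v b : ℕ} (x : Fin (r + 1)) (τ : Equiv.Perm (Fin r)) (h : v ≤ (x : ℕ))
    (hb : b < 2) : Q v b (pcons x τ) ↔ x = Fin.last r ∧ Q v (1 - b) τ := by
  by_cases hx : x = Fin.last r
  · subst hx
    simp only [Fin.val_last] at h
    unfold Q
    rw [av_pcons_last, jacobi_pcons, run_pcons_last τ h, invJ_pcons_last τ h, Fin.val_last,
      run_last]
    have : (1 + run v τ) % 2 = b ↔ run v τ % 2 = 1 - b := by omega
    rw [this]; simp
  · refine iff_of_false (fun hq => hx (av_pcons_ge x τ h hq.1)) (fun hq => hx hq.1)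

/-- Number of permutations in a given state. -/
noncomputable def N (r v b : ℕ) : ℕ := Nat.card {τ : Equiv.Perm (Fin r) // Q v b τ}

lemma card_and {α : Type*} (p : Prop) [Decidable p] (P : α → Prop) :
    Nat.card {a // p ∧ P a} = if p then Nat.card {a // P a} else 0 := by
  split_ifs with h <;> simp [h]

lemma N_succ (r v b : ℕ) (hb : b < 2) (hv : v ≤ r + 1) :
    N (r + 1) v b = (if v ≤ r then N r v (1 - b) else 0) +
      if b = 0 then ∑ x ∈ Finset.range v, (if Odd (v - x) then N r x 0 else 0) else 0 := by
  have h1 : ∀ x : Fin (r + 1), Nat.card {τ // Q v b (pcons x τ)} =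
      (fun x : ℕ => (if x = r then (if v ≤ r then N r v (1 - b) else 0) else 0) +
      if x < v then (if b = 0 then (if Odd (v - x) then N r x 0 else 0) else 0) else 0) x := by
    intro x
    dsimp only
    by_cases h : (x : ℕ) < v
    · simp only [Q_lt x _ h hv]
      rw [card_and, if_pos h]
      have : (if (x : ℕ) = r then (if v ≤ r then N r v (1 - b) else 0) else 0) = 0 := by
        split_ifs <;> first | rfl | omega
      rw [this, zero_add]
      by_cases hb0 : b = 0 <;> simp [hb0, N]
    · simp only [Q_ge x _ (not_lt.1 h) hb]
      rw [card_and, if_neg h, add_zero]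
      have : x = Fin.last r ↔ (x : ℕ) = r := by rw [Fin.ext_iff]; simp
      simp only [this]
      split_ifs <;> first | rfl | omega
  rw [N, card_pcons, Finset.sum_congr rfl (fun x _ => h1 x)]
  refine (Finset.sum_range (fun x : ℕ =>
      (if x = r then (if v ≤ r then N r v (1 - b) else 0) else 0) +
      if x < v then (if b = 0 then (if Odd (v - x) then N r x 0 else 0) else 0)
        else 0)).symm.trans ?_
  rw [Finset.sum_add_distrib]
  congr 1
  · rw [Finset.sum_ite_eq', if_pos (by simp)]
  · rw [← Finset.sum_filter]
    have : (Finset.range (r + 1)).filter (· < v) = Finset.range v := by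
      ext a; simp; omega
    rw [this]
    split_ifs <;> simp

lemma N_zero (b : ℕ) : N 0 0 b = if b = 0 then 1 else 0 := by
  have : ∀ τ : Equiv.Perm (Fin 0), Q 0 b τ ↔ b = 0 ∧ True := by
    intro τ
    have h : run 0 τ = 0 := cnt_false fun j => j.elim0
    unfold Q Av Avoids123 IsJacobi InvJ
    rw [h]
    simp [eq_comm]
  unfold N
  simp only [this]
  rw [card_and]
  simp

section numeric
open PowerSeries

lemma series_eq (s : ℕ → ℕ) (hs0 : s 0 = 1)
    (hs : ∀ n : ℕ, s (n + 1) = s n + ∑ k ∈ Finset.Icc 1 (n - 1), s k * s (n - 1 - k)) :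
    (PowerSeries.mk s) + X ^ 2 * PowerSeries.mk s =
      1 + X * PowerSeries.mk s + X ^ 2 * (PowerSeries.mk s * PowerSeries.mk s) := by
  ext n
  rcases n with _ | _ | n
  · simp [hs0, coeff_X_pow_mul', coeff_zero_X_mul]
  · have := hs 0
    simp [hs0] at this
    simp [hs0, this, coeff_X_pow_mul', coeff_one, coeff_succ_X_mul (n := 0)]
  · have := hs (n + 1)
    have e : Finset.range (n + 1) = insert 0 (Finset.Icc 1 n) := by
      ext a; simp; omega
    have hX : ∀ f : PowerSeries ℕ, coeff (n + 1 + 1) (X ^ 2 * f) = coeff n f :=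
      fun f => coeff_X_pow_mul f 2 n
    simp only [map_add, coeff_succ_X_mul, hX, coeff_one]
    simp only [coeff_mk, coeff_mul,
      Finset.Nat.sum_antidiagonal_eq_sum_range_succ (fun i j => s i * s j), Nat.succ_eq_add_one]
    rw [this, e, Finset.sum_insert (by simp)]
    simp [hs0]
    ring

variable (s : ℕ → ℕ)

/-- Coefficients of powers of the generating function. -/
noncomputable def p (j m : ℕ) : ℕ := coeff m ((PowerSeries.mk s) ^ j)

lemma p_rec (hS : (PowerSeries.mk s) + X ^ 2 * PowerSeries.mk s =
      1 + X * PowerSeries.mk s + X ^ 2 * (PowerSeries.mk s * PowerSeries.mk s)) (j m : ℕ) :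
    p s (j + 1) (m + 2) + p s (j + 1) m = p s j (m + 2) + p s (j + 1) (m + 1) + p s (j + 2) m := by
  have := congrArg (fun f => coeff (m + 2) (PowerSeries.mk s ^ j * f)) hS
  have e1 : PowerSeries.mk s ^ j * (PowerSeries.mk s + X ^ 2 * PowerSeries.mk s) =
    PowerSeries.mk s ^ (j + 1) + X ^ 2 * PowerSeries.mk s ^ (j + 1) := by ring
  have e2 : PowerSeries.mk s ^ j * (1 + X * PowerSeries.mk s + X ^ 2 * (PowerSeries.mk s * PowerSeries.mk s)) =
    PowerSeries.mk s ^ j + X * PowerSeries.mk s ^ (j + 1) + X ^ 2 * PowerSeries.mk s ^ (j + 2) := by ring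
  simp only [e1, e2, map_add, coeff_X_pow_mul] at this
  rw [show m + 2 = (m + 1) + 1 from rfl, coeff_succ_X_mul] at this
  exact this

lemma p_one (hS : (PowerSeries.mk s) + X ^ 2 * PowerSeries.mk s =
      1 + X * PowerSeries.mk s + X ^ 2 * (PowerSeries.mk s * PowerSeries.mk s)) (j : ℕ) :
    p s (j + 1) 1 = p s j 1 + p s (j + 1) 0 := by
  have := congrArg (fun f => coeff 1 (PowerSeries.mk s ^ j * f)) hS
  have e1 : PowerSeries.mk s ^ j * (PowerSeries.mk s + X ^ 2 * PowerSeries.mk s) =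
    PowerSeries.mk s ^ (j + 1) + X ^ 2 * PowerSeries.mk s ^ (j + 1) := by ring
  have e2 : PowerSeries.mk s ^ j * (1 + X * PowerSeries.mk s + X ^ 2 * (PowerSeries.mk s * PowerSeries.mk s)) =
    PowerSeries.mk s ^ j + X * PowerSeries.mk s ^ (j + 1) + X ^ 2 * PowerSeries.mk s ^ (j + 2) := by ring
  simp only [e1, e2, map_add, coeff_X_pow_mul'] at this
  rw [show 1 = 0 + 1 from rfl, coeff_succ_X_mul] at this
  simpa [p] using this

lemma p_zero (hs0 : s 0 = 1) (j : ℕ) : p s j 0 = 1 := by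
  simp [p, hs0]

/-- The telescoping sum. -/
noncomputable def T (j v : ℕ) : ℕ :=
  ∑ x ∈ Finset.range v, if Odd (v - x) then p s (j + 1 + (v - x - 1) / 2) x else 0

lemma T_rec (j v : ℕ) : T s j (v + 2) = p s (j + 1) (v + 1) + T s (j + 1) v := by
  unfold T
  rw [Finset.sum_range_succ, Finset.sum_range_succ]
  have e1 : v + 2 - (v + 1) = 1 := by omega
  have e2 : v + 2 - v = 2 := by omega
  rw [e1, e2, if_pos odd_one, if_neg (by decide), add_zero, add_comm]
  congr 1
  refine Finset.sum_congr rfl fun x hx => ?_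
  have hx := Finset.mem_range.1 hx
  have h1 : Odd (v + 2 - x) ↔ Odd (v - x) := by rw [Nat.odd_iff, Nat.odd_iff]; omega
  have h2 : j + 1 + (v + 2 - x - 1) / 2 = j + 1 + 1 + (v - x - 1) / 2 := by omega
  simp only [h1, h2]

lemma p_T (hs0 : s 0 = 1) (hS : (PowerSeries.mk s) + X ^ 2 * PowerSeries.mk s =
      1 + X * PowerSeries.mk s + X ^ 2 * (PowerSeries.mk s * PowerSeries.mk s)) :
    ∀ v j : ℕ, p s (j + 1) v = p s j v + T s j v := by
  intro v
  induction v using Nat.strong_induction_on with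
  | _ v ih =>
    intro j
    rcases v with _ | _ | v
    · simp [p_zero s hs0, T]
    · rw [zero_add, p_one s hS]; simp [T]
    · have h1 := p_rec s hS j v
      have h2 := ih v (by omega) (j + 1)
      rw [T_rec]
      simp only [add_assoc, Nat.reduceAdd] at *
      omega

theorem main_count (hs0 : s 0 = 1) (hS : (PowerSeries.mk s) + X ^ 2 * PowerSeries.mk s =
      1 + X * PowerSeries.mk s + X ^ 2 * (PowerSeries.mk s * PowerSeries.mk s)) (r : ℕ) :
    ∀ v, v ≤ r →
      N r v 0 = (if Even (r - v) then p s ((r - v) / 2 + 1) v else 0) ∧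
      N r v 1 = (if Odd (r - v) then p s ((r - v) / 2 + 1) v else 0) := by
  induction r with
  | zero =>
    intro v hv
    obtain rfl : v = 0 := by omega
    rw [N_zero, N_zero]
    simp [p_zero s hs0]
  | succ r ih =>
    intro v hv
    rw [N_succ r v 0 (by omega) hv, N_succ r v 1 (by omega) hv, if_pos rfl,
      if_neg one_ne_zero, add_zero]
    have hsum : ∑ x ∈ Finset.range v, (if Odd (v - x) then N r x 0 else 0) =
        if Even (r + 1 - v) then T s ((r + 1 - v) / 2) v else 0 := by
      unfold T
      split_ifs with he
      · refine Finset.sum_congr rfl fun x hx => ?_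
        have hx := Finset.mem_range.1 hx
        split_ifs with ho
        · rw [(ih x (by omega)).1]
          rw [Nat.even_iff] at he
          rw [Nat.odd_iff] at ho
          rw [if_pos (by rw [Nat.even_iff]; omega)]
          congr 1
          omega
        · rfl
      · refine Finset.sum_eq_zero fun x hx => ?_
        have hx := Finset.mem_range.1 hx
        split_ifs with ho
        · rw [(ih x (by omega)).1]
          rw [Nat.even_iff] at he
          rw [Nat.odd_iff] at ho
          rw [if_neg (by rw [Nat.even_iff]; omega)]
        · rfl
    rw [hsum]
    constructor
    · by_cases he : Even (r + 1 - v)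
      · rw [if_pos he, if_pos he, p_T s hs0 hS v]
        congr 1
        split_ifs with hvr
        · rw [(ih v hvr).2]
          rw [Nat.even_iff] at he
          rw [if_pos (by rw [Nat.odd_iff]; omega)]
          congr 1
          omega
        · obtain rfl : v = r + 1 := by omega
          simp [p, coeff_one]
      · rw [if_neg he, if_neg he, add_zero]
        split_ifs with hvr
        · rw [(ih v hvr).2]
          rw [Nat.even_iff] at he
          rw [if_neg (by rw [Nat.odd_iff]; omega)]
        · rfl
    · split_ifs with hvr ho ho
      · rw [(ih v hvr).1]
        rw [Nat.odd_iff] at ho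
        rw [if_pos (by rw [Nat.even_iff]; omega)]
        congr 1
        omega
      · rw [(ih v hvr).1]
        rw [Nat.odd_iff] at ho
        rw [if_neg (by rw [Nat.even_iff]; omega)]
      · rw [Nat.odd_iff] at ho; omega
      · rfl

end numeric

lemma Q_top {n : ℕ} (π : Equiv.Perm (Fin n)) :
    Q n 0 π ↔ Avoids123 π ∧ IsJacobi π ∧ IsJacobi π⁻¹ := by
  unfold Q Av
  rw [run_last]
  have h1 : ∀ i j : Fin n, i < j → n ≤ (π i : ℕ) → ¬ π i < π j := by
    intro i j _ h; have := (π i).2; omega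
  have h2 : InvJ n π ↔ IsJacobi π⁻¹ := by
    unfold InvJ IsJacobi
    refine forall_congr' fun y => ?_
    rw [imp_iff_right y.2]
    refine iff_of_eq (congrArg _ ?_)
    change _ = cnt _
    refine cnt_congr fun j => ?_
    simp
  rw [h2]
  simp only [Nat.zero_mod, true_and]
  tauto

end JacobiAux

/-- The number of 123-avoiding doubly Jacobi permutations of `[n]` equals the secondary
structure number `s n`, where `s 0 = 1` and `s (n+1) = s n + ∑_{k=1}^{n-1} s k * s (n-1-k)`. -/
theorem jacobi_avoid_123_doubly_count (s : ℕ → ℕ) (hs0 : s 0 = 1)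
    (hs : ∀ n : ℕ, s (n + 1) = s n + ∑ k ∈ Finset.Icc 1 (n - 1), s k * s (n - 1 - k))
    (n : ℕ) :
    Nat.card {π : Equiv.Perm (Fin n) //
        Avoids123 π ∧ IsJacobi π ∧ IsJacobi π⁻¹} = s n := by
  have hS := JacobiAux.series_eq s hs0 hs
  have h := (JacobiAux.main_count s hs0 hS n n le_rfl).1
  have e : JacobiAux.N n n 0 = Nat.card {π : Equiv.Perm (Fin n) //
      Avoids123 π ∧ IsJacobi π ∧ IsJacobi π⁻¹} := by
    unfold JacobiAux.N
    simp only [JacobiAux.Q_top]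
  rw [← e, h]
  simp [JacobiAux.p]
end

section
/- For all n ≥ 0, the number of Jacobi permutations of [n] avoiding the pattern 321 equals the Catalan number C_{⌊n/2⌋} = (1/(⌊n/2⌋+1))·C(2⌊n/2⌋, ⌊n/2⌋). -/
/-- Structural description of the 321-avoiding Jacobi permutations. -/
def PShape {n : ℕ} (π : Equiv.Perm (Fin n)) : Prop :=
  (∀ i j : Fin n, i < j → Odd ((i : ℕ) + n) → Odd ((j : ℕ) + n) → π i < π j) ∧
  (∀ i j : Fin n, i < j → Even ((i : ℕ) + n) → Even ((j : ℕ) + n) → π i < π j) ∧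
  (∀ i j : Fin n, (j : ℕ) = i + 1 → Even ((i : ℕ) + n) → π j < π i)

theorem rhoLen_eq {n : ℕ} (π : Equiv.Perm (Fin n)) (k : Fin n) (m : ℕ) (hkm : (k : ℕ) < m)
    (hmn : m ≤ n) (h1 : ∀ i : Fin n, k < i → (i : ℕ) < m → π k < π i)
    (h2 : ∀ i : Fin n, (i : ℕ) = m → π i < π k) : rhoLen π k = m - k - 1 := by
  unfold rhoLen
  have e : {j : Fin n // k < j ∧ ∀ i : Fin n, k < i → i ≤ j → π k < π i} ≃
      ↥(Finset.Ioo (k : ℕ) m) := by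
    refine Equiv.ofBijective (fun j => ⟨(j.1 : ℕ), ?_⟩) ⟨?_, ?_⟩
    · obtain ⟨j, hj, hj2⟩ := j
      rw [Finset.mem_Ioo]
      refine ⟨hj, ?_⟩
      by_contra hc
      push Not at hc
      have hc' : m ≤ (j : ℕ) := hc
      have hmlt : m < n := lt_of_le_of_lt hc' j.2
      have a := h2 ⟨m, hmlt⟩ rfl
      have b := hj2 ⟨m, hmlt⟩ (by simpa [Fin.lt_def] using hkm) (by simpa [Fin.le_def] using hc')
      exact absurd (lt_trans a b) (lt_irrefl _)
    · intro a b hab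
      apply Subtype.ext
      apply Fin.ext
      simpa using hab
    · rintro ⟨x, hx⟩
      rw [Finset.mem_Ioo] at hx
      refine ⟨⟨⟨x, by omega⟩, by simpa [Fin.lt_def] using hx.1, ?_⟩, rfl⟩
      intro i hi hi2
      apply h1 i hi
      have : (i : ℕ) ≤ x := hi2
      omega
  rw [Nat.card_congr e, Nat.card_eq_fintype_card, Fintype.card_coe, Nat.card_Ioo]

theorem first_smaller {n : ℕ} (π : Equiv.Perm (Fin n)) (k : Fin n)
    (h : ∃ j, k < j ∧ π j < π k) :
    ∃ m : Fin n, k < m ∧ π m < π k ∧ ∀ i, k < i → i < m → π k < π i := by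
  classical
  obtain ⟨m, hm, hmin⟩ := WellFounded.has_min (wellFounded_lt (α := Fin n))
    {j | k < j ∧ π j < π k} h
  refine ⟨m, hm.1, hm.2, fun i hi him => ?_⟩
  by_contra hc
  have hne : π i ≠ π k := fun he => (ne_of_gt hi) (π.injective he)
  exact hmin i ⟨hi, lt_of_le_of_ne (not_lt.mp hc) hne⟩ him

theorem forward_aux {n : ℕ} (π : Equiv.Perm (Fin n)) (hJ : IsJacobi π) (hA : Avoids321 π) :
    ∀ d : ℕ, ∀ k : Fin n, n - (k : ℕ) = d →
      (Odd ((k : ℕ) + n) → ∀ j, k < j → π k < π j) ∧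
      (Even ((k : ℕ) + n) → ∀ j : Fin n, (j : ℕ) = k + 1 → π j < π k) := by
  intro d
  induction d using Nat.strong_induction_on with
  | _ d ih =>
    intro k hk
    refine ⟨fun ho j hj => ?_, fun he j hj => ?_⟩
    · by_contra hc
      have hne : π j ≠ π k := fun he => (ne_of_gt hj) (π.injective he)
      obtain ⟨m, hkm, hm, hlt⟩ := first_smaller π k
        ⟨j, hj, lt_of_le_of_ne (not_lt.mp hc) hne⟩
      have hkm' : (k : ℕ) < m := hkm
      have hr := rhoLen_eq π k m hkm' m.2.le (fun i hi him => hlt i hi him)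
        (fun i hi => by rw [Fin.ext hi]; exact hm)
      have hev := hJ k
      rw [hr] at hev
      have hmE : Even ((m : ℕ) + n) := by
        rw [Nat.even_iff] at hev ⊢
        rw [Nat.odd_iff] at ho
        omega
      have hmn : (m : ℕ) + 1 < n := by
        have := m.2
        rw [Nat.even_iff] at hmE
        omega
      have := (ih (n - (m : ℕ)) (by omega) m rfl).2 hmE ⟨m + 1, hmn⟩ rfl
      exact hA ⟨k, m, ⟨m + 1, hmn⟩, hkm, by simp [Fin.lt_def], this, hm⟩
    · by_contra hc
      have hkj : k < j := by rw [Fin.lt_def]; omega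
      have hne : π j ≠ π k := fun he => (ne_of_gt hkj) (π.injective he)
      have hlt : π k < π j := lt_of_le_of_ne (not_lt.mp hc) (Ne.symm hne)
      have hjo : Odd ((j : ℕ) + n) := by
        rw [Nat.even_iff] at he
        rw [Nat.odd_iff]
        omega
      have hj2 := (ih (n - (j : ℕ)) (by omega) j rfl).1 hjo
      have hr := rhoLen_eq π k n k.2 le_rfl (fun i hi _ => by
        rcases eq_or_ne i j with rfl | hij
        · exact hlt
        · refine lt_trans hlt (hj2 i ?_)
          have : (i : ℕ) ≠ j := fun h => hij (Fin.ext h)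
          rw [Fin.lt_def] at hi ⊢
          omega) (fun i hi => by have := i.2; omega)
      have hev := hJ k
      rw [hr] at hev
      have := k.2
      rw [Nat.even_iff] at hev he
      omega

theorem shape_iff {n : ℕ} (π : Equiv.Perm (Fin n)) :
    (IsJacobi π ∧ Avoids321 π) ↔ PShape π := by
  constructor
  · rintro ⟨hJ, hA⟩
    have F := fun k => forward_aux π hJ hA _ k rfl
    refine ⟨fun i j hij hi _ => (F i).1 hi j hij, fun i j hij hi hj => ?_,
      fun i j hij hi => (F i).2 hi j hij⟩
    by_contra hc
    have hne : π j ≠ π i := fun he => (ne_of_gt hij) (π.injective he)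
    have hlt := lt_of_le_of_ne (not_lt.mp hc) hne
    have hmn : (j : ℕ) + 1 < n := by
      have := j.2
      rw [Nat.even_iff] at hj
      omega
    exact hA ⟨i, j, ⟨j + 1, hmn⟩, hij, by simp [Fin.lt_def], (F j).2 hj ⟨j + 1, hmn⟩ rfl, hlt⟩
  · rintro ⟨hb, ht, hd⟩
    constructor
    · intro k
      rcases Nat.even_or_odd ((k : ℕ) + n) with he | ho
      · have hmn : (k : ℕ) + 1 < n := by
          have := k.2
          rw [Nat.even_iff] at he
          omega
        rw [rhoLen_eq π k (k + 1) (by omega) (by omega)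
          (fun i hi h => by rw [Fin.lt_def] at hi; omega) (fun i hi => hd k i hi he)]
        simp
      · rw [rhoLen_eq π k n k.2 le_rfl ?_ (fun i hi => by have := i.2; omega)]
        · have := k.2
          rw [Nat.odd_iff] at ho
          rw [Nat.even_iff]
          omega
        · intro i hi _
          rcases Nat.even_or_odd ((i : ℕ) + n) with he | ho'
          · have hmn : (i : ℕ) + 1 < n := by
              have := i.2
              rw [Nat.even_iff] at he
              omega
            refine lt_trans (hb k ⟨i + 1, hmn⟩ ?_ ho ?_) (hd i ⟨i + 1, hmn⟩ rfl he)
            · rw [Fin.lt_def] at hi ⊢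
              simp only
              omega
            · rw [Nat.even_iff] at he
              rw [Nat.odd_iff]
              simp only
              omega
          · exact hb k i hi ho ho'
    · rintro ⟨i, j, k, hij, hjk, h1, h2⟩
      have G : ∀ a b : Fin n, a < b → π b < π a → ¬ ((a : ℕ) % 2 = (b : ℕ) % 2) := by
        intro a b hab hba hp
        rcases Nat.even_or_odd ((a : ℕ) + n) with he | ho
        · exact lt_asymm hba (ht a b hab he (by rw [Nat.even_iff] at *; omega))
        · exact lt_asymm hba (hb a b hab ho (by rw [Nat.odd_iff] at *; omega))
      have a1 := G i j hij h2
      have a2 := G j k hjk h1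
      have a3 := G i k (hij.trans hjk) (h1.trans h2)
      omega

theorem card_odd (n : ℕ) (hn : Even n) :
    Nat.card {π : Equiv.Perm (Fin (n + 1)) // PShape π} =
      Nat.card {π : Equiv.Perm (Fin n) // PShape π} := by
  symm
  have key : ∀ e : Equiv.Perm (Fin n),
      PShape (Equiv.Perm.decomposeFin.symm (0, e)) ↔ PShape e := by
    intro e
    have h0 : Equiv.Perm.decomposeFin.symm (0, e) 0 = 0 := by simp
    have hs : ∀ i, Equiv.Perm.decomposeFin.symm (0, e) i.succ = (e i).succ := by intro i; simp
    have par1 : ∀ i : Fin n, Odd ((i.succ : ℕ) + (n + 1)) ↔ Odd ((i : ℕ) + n) := by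
      intro i; simp only [Nat.odd_iff, Fin.val_succ]; omega
    have par2 : ∀ i : Fin n, Even ((i.succ : ℕ) + (n + 1)) ↔ Even ((i : ℕ) + n) := by
      intro i; simp only [Nat.even_iff, Fin.val_succ]; omega
    have par0 : ¬ Even (((0 : Fin (n + 1)) : ℕ) + (n + 1)) := by
      rw [Nat.even_iff] at *; simp only [Fin.val_zero]; omega
    constructor
    · rintro ⟨hb, ht, hd⟩
      refine ⟨fun i j hij hi hj => ?_, fun i j hij hi hj => ?_, fun i j hij hi => ?_⟩
      · have := hb i.succ j.succ (by simpa using hij) ((par1 i).2 hi) ((par1 j).2 hj)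
        rw [hs, hs] at this
        simpa using this
      · have := ht i.succ j.succ (by simpa using hij) ((par2 i).2 hi) ((par2 j).2 hj)
        rw [hs, hs] at this
        simpa using this
      · have := hd i.succ j.succ (by simpa using hij) ((par2 i).2 hi)
        rw [hs, hs] at this
        simpa using this
    · rintro ⟨hb, ht, hd⟩
      refine ⟨fun i j => ?_, fun i j => ?_, fun i j => ?_⟩
      · induction j using Fin.cases with
        | zero => intro h; simp at h
        | succ j =>
          induction i using Fin.cases with
          | zero => intro _ _ _; rw [h0, hs]; exact Fin.succ_pos _
          | succ i =>
            intro hij hi hj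
            rw [hs, hs, Fin.succ_lt_succ_iff]
            exact hb i j (by simpa using hij) ((par1 i).1 hi) ((par1 j).1 hj)
      · induction j using Fin.cases with
        | zero => intro h; simp at h
        | succ j =>
          induction i using Fin.cases with
          | zero => intro _ h; exact absurd h par0
          | succ i =>
            intro hij hi hj
            rw [hs, hs, Fin.succ_lt_succ_iff]
            exact ht i j (by simpa using hij) ((par2 i).1 hi) ((par2 j).1 hj)
      · induction j using Fin.cases with
        | zero => intro h; simp at h
        | succ j =>
          induction i using Fin.cases with
          | zero => intro _ h; exact absurd h par0
          | succ i =>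
            intro hij hi
            rw [hs, hs, Fin.succ_lt_succ_iff]
            exact hd i j (by simpa using hij) ((par2 i).1 hi)
  refine Nat.card_eq_of_bijective
    (fun e => ⟨Equiv.Perm.decomposeFin.symm (0, e.1), (key e.1).2 e.2⟩) ⟨?_, ?_⟩
  · intro a b hab
    have := congrArg Subtype.val hab
    have := Equiv.Perm.decomposeFin.symm.injective this
    exact Subtype.ext (Prod.ext_iff.1 this).2
  · rintro ⟨π, hπ⟩
    have hlt : ∀ j, 0 < j → π 0 < π j := by
      have hJ := (shape_iff π).2 hπ
      refine (forward_aux π hJ.1 hJ.2 _ 0 rfl).1 ?_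
      rw [Nat.even_iff] at hn
      rw [Nat.odd_iff]
      simp only [Fin.val_zero]
      omega
    have h00 : π 0 = 0 := by
      by_contra hne
      have hx : π.symm 0 ≠ 0 := fun h => hne (by have := π.apply_symm_apply 0; rwa [h] at this)
      have := hlt (π.symm 0) (Fin.pos_of_ne_zero hx)
      simp at this
    have hfst : Equiv.Perm.decomposeFin π = (0, (Equiv.Perm.decomposeFin π).2) := by
      have h := Equiv.Perm.decomposeFin_symm_apply_zero (Equiv.Perm.decomposeFin π).1
        (Equiv.Perm.decomposeFin π).2
      rw [Prod.mk.eta, Equiv.symm_apply_apply, h00] at h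
      exact Prod.ext h.symm rfl
    have hpi : Equiv.Perm.decomposeFin.symm (0, (Equiv.Perm.decomposeFin π).2) = π := by
      rw [← hfst, Equiv.symm_apply_apply]
    refine ⟨⟨(Equiv.Perm.decomposeFin π).2, (key _).1 (by rw [hpi]; exact hπ)⟩, ?_⟩
    exact Subtype.ext hpi

theorem count_take_ofFn {N : ℕ} (f : Fin N → DyckStep) (a : DyckStep) (i : ℕ) :
    ((List.ofFn f).take i).count a =
      (Finset.univ.filter (fun v : Fin N => (v : ℕ) < i ∧ f v = a)).card := by
  induction N generalizing i with
  | zero => simp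
  | succ N ih =>
    cases i with
    | zero => simp
    | succ i =>
      rw [List.ofFn_succ, List.take_succ_cons, List.count_cons, ih, Fin.card_filter_univ_succ]
      by_cases h : f 0 = a <;> simp [h]

/-- Even position `2j`. -/
def evp {m : ℕ} (j : Fin m) : Fin (2 * m) := ⟨2 * j, by omega⟩
/-- Odd position `2j+1`. -/
def odp {m : ℕ} (j : Fin m) : Fin (2 * m) := ⟨2 * j + 1, by omega⟩

theorem pos_cases {m : ℕ} (k : Fin (2 * m)) :
    (∃ j : Fin m, k = evp j) ∨ (∃ j : Fin m, k = odp j) := by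
  have := k.2
  rcases Nat.even_or_odd' (k : ℕ) with ⟨c, hc | hc⟩
  · exact Or.inl ⟨⟨c, by omega⟩, Fin.ext hc⟩
  · exact Or.inr ⟨⟨c, by omega⟩, Fin.ext hc⟩

theorem shape_even_iff {m : ℕ} (π : Equiv.Perm (Fin (2 * m))) :
    PShape π ↔ StrictMono (fun j : Fin m => π (odp j)) ∧ StrictMono (fun j : Fin m => π (evp j)) ∧
      ∀ j : Fin m, π (odp j) < π (evp j) := by
  constructor
  · rintro ⟨hb, ht, hd⟩
    refine ⟨fun a b hab => hb _ _ ?_ ?_ ?_, fun a b hab => ht _ _ ?_ ?_ ?_,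
      fun j => hd _ _ ?_ ?_⟩
    · rw [Fin.lt_def] at *; simp only [odp]; omega
    · rw [Nat.odd_iff]; simp only [odp]; omega
    · rw [Nat.odd_iff]; simp only [odp]; omega
    · rw [Fin.lt_def] at *; simp only [evp]; omega
    · rw [Nat.even_iff]; simp only [evp]; omega
    · rw [Nat.even_iff]; simp only [evp]; omega
    · simp only [evp, odp]
    · rw [Nat.even_iff]; simp only [evp]; omega
  · rintro ⟨hb, ht, hd⟩
    refine ⟨fun i j hij hi hj => ?_, fun i j hij hi hj => ?_, fun i j hij hi => ?_⟩
    · rcases pos_cases i with ⟨a, rfl⟩ | ⟨a, rfl⟩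
      · rw [Nat.odd_iff] at hi; simp only [evp] at hi; omega
      rcases pos_cases j with ⟨b, rfl⟩ | ⟨b, rfl⟩
      · rw [Nat.odd_iff] at hj; simp only [evp] at hj; omega
      apply hb
      rw [Fin.lt_def] at *; simp only [odp] at hij; omega
    · rcases pos_cases i with ⟨a, rfl⟩ | ⟨a, rfl⟩
      swap
      · rw [Nat.even_iff] at hi; simp only [odp] at hi; omega
      rcases pos_cases j with ⟨b, rfl⟩ | ⟨b, rfl⟩
      swap
      · rw [Nat.even_iff] at hj; simp only [odp] at hj; omega
      apply ht
      rw [Fin.lt_def] at *; simp only [evp] at hij; omega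
    · rcases pos_cases i with ⟨a, rfl⟩ | ⟨a, rfl⟩
      swap
      · rw [Nat.even_iff] at hi; simp only [odp] at hi; omega
      have : j = odp a := Fin.ext hij
      rw [this]
      exact hd a

/-- The step attached to a value. -/
def stepOf {m : ℕ} (π : Equiv.Perm (Fin (2 * m))) (v : Fin (2 * m)) : DyckStep :=
  if Even ((π.symm v : Fin (2 * m)) : ℕ) then DyckStep.D else DyckStep.U

theorem stepOf_evp {m : ℕ} (π : Equiv.Perm (Fin (2 * m))) (j : Fin m) :
    stepOf π (π (evp j)) = DyckStep.D := by
  simp [stepOf, evp]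

theorem stepOf_odp {m : ℕ} (π : Equiv.Perm (Fin (2 * m))) (j : Fin m) :
    stepOf π (π (odp j)) = DyckStep.U := by
  simp [stepOf, odp]

theorem val_cases {m : ℕ} (π : Equiv.Perm (Fin (2 * m))) (v : Fin (2 * m)) :
    (∃ j : Fin m, v = π (evp j)) ∨ (∃ j : Fin m, v = π (odp j)) := by
  rcases pos_cases (π.symm v) with ⟨j, hj⟩ | ⟨j, hj⟩
  · exact Or.inl ⟨j, by rw [← hj]; simp⟩
  · exact Or.inr ⟨j, by rw [← hj]; simp⟩

theorem evp_inj {m : ℕ} : Function.Injective (evp (m := m)) := by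
  intro a b h
  have := congrArg Fin.val h
  simp only [evp] at this
  exact Fin.ext (by omega)

theorem odp_inj {m : ℕ} : Function.Injective (odp (m := m)) := by
  intro a b h
  have := congrArg Fin.val h
  simp only [odp] at this
  exact Fin.ext (by omega)

theorem filt_D {m : ℕ} (π : Equiv.Perm (Fin (2 * m))) (i : ℕ) :
    (Finset.univ.filter (fun v : Fin (2 * m) => (v : ℕ) < i ∧ stepOf π v = DyckStep.D)).card =
    (Finset.univ.filter (fun j : Fin m => (π (evp j) : ℕ) < i)).card := by
  symm
  refine Finset.card_bij (fun j _ => π (evp j)) ?_ ?_ ?_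
  · intro j hj
    simpa [stepOf_evp] using hj
  · intro a _ b _ h
    exact evp_inj (π.injective h)
  · intro v hv
    simp only [Finset.mem_filter, Finset.mem_univ, true_and] at hv
    rcases val_cases π v with ⟨j, rfl⟩ | ⟨j, rfl⟩
    · exact ⟨j, by simpa using hv.1, rfl⟩
    · rw [stepOf_odp] at hv
      exact absurd hv.2 (by simp)

theorem filt_U {m : ℕ} (π : Equiv.Perm (Fin (2 * m))) (i : ℕ) :
    (Finset.univ.filter (fun v : Fin (2 * m) => (v : ℕ) < i ∧ stepOf π v = DyckStep.U)).card =
    (Finset.univ.filter (fun j : Fin m => (π (odp j) : ℕ) < i)).card := by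
  symm
  refine Finset.card_bij (fun j _ => π (odp j)) ?_ ?_ ?_
  · intro j hj
    simpa [stepOf_odp] using hj
  · intro a _ b _ h
    exact odp_inj (π.injective h)
  · intro v hv
    simp only [Finset.mem_filter, Finset.mem_univ, true_and] at hv
    rcases val_cases π v with ⟨j, rfl⟩ | ⟨j, rfl⟩
    · rw [stepOf_evp] at hv
      exact absurd hv.2 (by simp)
    · exact ⟨j, by simpa using hv.1, rfl⟩

theorem count_D_word {m : ℕ} (π : Equiv.Perm (Fin (2 * m))) :
    (List.ofFn (stepOf π)).count DyckStep.D = m := by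
  have h := count_take_ofFn (stepOf π) DyckStep.D (2 * m)
  rw [filt_D, List.take_of_length_le (by simp)] at h
  simpa using h

theorem count_U_word {m : ℕ} (π : Equiv.Perm (Fin (2 * m))) :
    (List.ofFn (stepOf π)).count DyckStep.U = m := by
  have h := count_take_ofFn (stepOf π) DyckStep.U (2 * m)
  rw [filt_U, List.take_of_length_le (by simp)] at h
  simpa using h

/-- The Dyck word of a shaped permutation. -/
def toDyck {m : ℕ} (π : Equiv.Perm (Fin (2 * m))) (h : PShape π) : DyckWord where
  toList := List.ofFn (stepOf π)
  count_U_eq_count_D := by rw [count_D_word, count_U_word]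
  count_D_le_count_U i := by
    rw [count_take_ofFn, count_take_ofFn, filt_D, filt_U]
    apply Finset.card_le_card
    intro j hj
    simp only [Finset.mem_filter, Finset.mem_univ, true_and] at hj ⊢
    exact lt_trans (((shape_even_iff π).1 h).2.2 j) hj

theorem perm_ext_of_step {m : ℕ} (π τ : Equiv.Perm (Fin (2 * m))) (hπ : PShape π) (hτ : PShape τ)
    (h : stepOf π = stepOf τ) : π = τ := by
  rw [shape_even_iff] at hπ hτ
  have hU : (Finset.univ.filter (fun v => stepOf π v = DyckStep.U)).card = m := by
    have := filt_U π (2 * m)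
    simpa using this
  have hD : (Finset.univ.filter (fun v => stepOf π v = DyckStep.D)).card = m := by
    have := filt_D π (2 * m)
    simpa using this
  have a1 := Finset.orderEmbOfFin_unique hU (f := fun j => π (odp j))
    (fun j => by simp [stepOf_odp]) hπ.1
  have a2 := Finset.orderEmbOfFin_unique hU (f := fun j => τ (odp j))
    (fun j => by simp [h, stepOf_odp]) hτ.1
  have b1 := Finset.orderEmbOfFin_unique hD (f := fun j => π (evp j))
    (fun j => by simp [stepOf_evp]) hπ.2.1
  have b2 := Finset.orderEmbOfFin_unique hD (f := fun j => τ (evp j))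
    (fun j => by simp [h, stepOf_evp]) hτ.2.1
  apply Equiv.ext
  intro k
  rcases pos_cases k with ⟨j, rfl⟩ | ⟨j, rfl⟩
  · exact congrFun (b1.trans b2.symm) j
  · exact congrFun (a1.trans a2.symm) j

theorem exists_perm {m : ℕ} (f : Fin (2 * m) → DyckStep)
    (hU : (Finset.univ.filter (fun v => f v = DyckStep.U)).card = m)
    (hD : (Finset.univ.filter (fun v => f v = DyckStep.D)).card = m)
    (hb : ∀ i : ℕ, (Finset.univ.filter (fun v : Fin (2 * m) => (v : ℕ) < i ∧ f v = DyckStep.D)).card ≤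
      (Finset.univ.filter (fun v : Fin (2 * m) => (v : ℕ) < i ∧ f v = DyckStep.U)).card) :
    ∃ π : Equiv.Perm (Fin (2 * m)), PShape π ∧ stepOf π = f := by
  set s := Finset.orderEmbOfFin _ hU with hs
  set t := Finset.orderEmbOfFin _ hD with ht
  have sU : ∀ j, f (s j) = DyckStep.U := fun j => by
    exact (Finset.mem_filter.1 (Finset.orderEmbOfFin_mem _ hU j)).2
  have tD : ∀ j, f (t j) = DyckStep.D := fun j => by
    exact (Finset.mem_filter.1 (Finset.orderEmbOfFin_mem _ hD j)).2
  have sR : ∀ v, f v = DyckStep.U → ∃ j, s j = v := by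
    intro v hv
    have := Finset.range_orderEmbOfFin _ hU
    have h2 : v ∈ Set.range s := by rw [hs, this]; simpa using hv
    exact h2
  have hne : ∀ a b, s a ≠ t b := by
    intro a b h
    have := sU a
    rw [h, tD b] at this
    simp at this
  let g : Fin (2 * m) → Fin (2 * m) := fun k =>
    if Even (k : ℕ) then t ⟨(k : ℕ) / 2, by omega⟩ else s ⟨(k : ℕ) / 2, by omega⟩
  have gev : ∀ j, g (evp j) = t j := by
    intro j
    simp [g, evp]
  have god : ∀ j, g (odp j) = s j := by
    intro j
    have h1 : ¬ Even (2 * (j : ℕ) + 1) := by rw [Nat.even_iff]; omega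
    have h2 : (2 * (j : ℕ) + 1) / 2 = j := by omega
    simp only [g, odp, h1, if_false, h2]
  have ginj : Function.Injective g := by
    intro a b hab
    rcases pos_cases a with ⟨i, rfl⟩ | ⟨i, rfl⟩ <;> rcases pos_cases b with ⟨j, rfl⟩ | ⟨j, rfl⟩
    · rw [gev, gev] at hab; rw [t.injective hab]
    · rw [gev, god] at hab; exact absurd hab.symm (hne _ _)
    · rw [gev, god] at hab; exact absurd hab (hne _ _)
    · rw [god, god] at hab; rw [s.injective hab]
  let π : Equiv.Perm (Fin (2 * m)) := Equiv.ofBijective g (Finite.injective_iff_bijective.1 ginj)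
  have pev : ∀ j, π (evp j) = t j := gev
  have pod : ∀ j, π (odp j) = s j := god
  refine ⟨π, (shape_even_iff π).2 ⟨?_, ?_, ?_⟩, ?_⟩
  · simp only [pod]; exact s.strictMono
  · simp only [pev]; exact t.strictMono
  · intro j
    rw [pod, pev]
    by_contra hc
    have hlt : t j < s j := lt_of_le_of_ne (not_lt.mp hc) (hne j j).symm
    have h1 : (j : ℕ) + 1 ≤ (Finset.univ.filter
        (fun v : Fin (2 * m) => (v : ℕ) < (t j : ℕ) + 1 ∧ f v = DyckStep.D)).card := by
      have : ((Finset.Iic j).image t) ⊆ Finset.univ.filter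
        (fun v : Fin (2 * m) => (v : ℕ) < (t j : ℕ) + 1 ∧ f v = DyckStep.D) := by
        intro v hv
        rw [Finset.mem_image] at hv
        obtain ⟨i, hi, rfl⟩ := hv
        have : t i ≤ t j := t.monotone (Finset.mem_Iic.1 hi)
        rw [Fin.le_def] at this
        simp only [Finset.mem_filter, Finset.mem_univ, true_and]
        exact ⟨by omega, tD i⟩
      have h := Finset.card_le_card this
      rw [Finset.card_image_of_injective _ t.injective, Fin.card_Iic] at h
      exact h
    have h2 : (Finset.univ.filter
        (fun v : Fin (2 * m) => (v : ℕ) < (t j : ℕ) + 1 ∧ f v = DyckStep.U)).card ≤ j := by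
      have : Finset.univ.filter
        (fun v : Fin (2 * m) => (v : ℕ) < (t j : ℕ) + 1 ∧ f v = DyckStep.U) ⊆ ((Finset.Iio j).image s) := by
        intro v hv
        simp only [Finset.mem_filter, Finset.mem_univ, true_and] at hv
        obtain ⟨i, rfl⟩ := sR v hv.2
        rw [Finset.mem_image]
        refine ⟨i, ?_, rfl⟩
        rw [Finset.mem_Iio]
        apply s.lt_iff_lt.1
        rw [Fin.lt_def] at *
        omega
      have h := Finset.card_le_card this
      rw [Finset.card_image_of_injective _ s.injective, Fin.card_Iio] at h
      exact h
    have := hb ((t j : ℕ) + 1)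
    omega
  · funext v
    rcases val_cases π v with ⟨j, rfl⟩ | ⟨j, rfl⟩
    · rw [stepOf_evp, pev, tD]
    · rw [stepOf_odp, pod, sU]

theorem card_even (m : ℕ) :
    Nat.card {π : Equiv.Perm (Fin (2 * m)) // PShape π} = catalan m := by
  rw [← DyckWord.card_dyckWord_semilength_eq_catalan, ← Nat.card_eq_fintype_card]
  refine Nat.card_eq_of_bijective
    (fun π => (⟨toDyck π.1 π.2, count_U_word π.1⟩ : {p : DyckWord // p.semilength = m})) ⟨?_, ?_⟩
  · intro a b hab
    have h := congrArg (fun p => p.1.toList) hab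
    have h2 : List.ofFn (stepOf a.1) = List.ofFn (stepOf b.1) := h
    exact Subtype.ext (perm_ext_of_step _ _ a.2 b.2 (List.ofFn_injective h2))
  · rintro ⟨p, hp⟩
    have hlen : p.toList.length = 2 * m := by rw [← hp, p.two_mul_semilength_eq_length]
    obtain ⟨f, hf⟩ : ∃ f : Fin (2 * m) → DyckStep, List.ofFn f = p.toList := by
      rw [← hlen]
      exact ⟨p.toList.get, List.ofFn_get _⟩
    have hc : ∀ a, p.toList.count a = (Finset.univ.filter (fun v => f v = a)).card := by
      intro a
      have := count_take_ofFn f a (2 * m)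
      rw [List.take_of_length_le (by simp), hf] at this
      simpa using this
    obtain ⟨π, hπ, hs⟩ := exists_perm f
      (by rw [← hc]; exact hp)
      (by rw [← hc, ← p.semilength_eq_count_D]; exact hp)
      (fun i => by rw [← count_take_ofFn, ← count_take_ofFn, hf]; exact p.count_D_le_count_U i)
    refine ⟨⟨π, hπ⟩, Subtype.ext (DyckWord.ext ?_)⟩
    change List.ofFn (stepOf π) = p.toList
    rw [hs, hf]

theorem card_shape (n : ℕ) :
    Nat.card {π : Equiv.Perm (Fin n) // PShape π} = catalan (n / 2) := by
  rcases Nat.even_or_odd' n with ⟨c, rfl | rfl⟩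
  · rw [card_even, Nat.mul_div_cancel_left c (by norm_num)]
  · rw [card_odd _ (even_two_mul c), card_even]
    congr 1
    omega

/-- The number of 321-avoiding Jacobi permutations of `[n]` is the Catalan number
`C_{⌊n/2⌋} = (1/(⌊n/2⌋+1)) C(2⌊n/2⌋, ⌊n/2⌋)`. -/
theorem jacobi_avoid_321_count (n : ℕ) :
    (Nat.card {π : Equiv.Perm (Fin n) // IsJacobi π ∧ Avoids321 π} : ℚ)
      = (1 / (((n / 2 : ℕ) : ℚ) + 1)) * ((2 * (n / 2)).choose (n / 2) : ℕ) := by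
  rw [Nat.card_congr (Equiv.subtypeEquivRight (fun π => shape_iff π)), card_shape]
  have h := succ_mul_catalan_eq_centralBinom (n / 2)
  rw [Nat.centralBinom_eq_two_mul_choose] at h
  rw [← h]
  push_cast
  have : (((n / 2 : ℕ) : ℚ) + 1) ≠ 0 := by positivity
  field_simp
end

section
/- For all n ≥ 1: the number of Jacobi permutations π of [2n] avoiding 321 with last letter π_{2n} = k equals ((2n−k)/n)·C(k−1, n−1) if n ≤ k ≤ 2n−1, and 0 otherwise; and the number of Jacobi permutations π of [2n+1] avoiding 321 with last letter π_{2n+1} = k equals ((2n−k+1)/n)·C(k−2, n−1) if n+1 ≤ k ≤ 2n, and 0 otherwise. -/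
/-- The last letter of `π`, as an element of `[n] = {1,…,n}` (junk value `0` if `n = 0`). -/
def lastVal {n : ℕ} (π : Equiv.Perm (Fin n)) : ℕ :=
  if h : 0 < n then (π ⟨n - 1, Nat.sub_lt h Nat.one_pos⟩ : ℕ) + 1 else 0

namespace JacAux
open Finset

def Q {n : ℕ} (π : Equiv.Perm (Fin n)) (k j : Fin n) : Prop :=
  k < j ∧ ∀ i : Fin n, k < i → i ≤ j → π k < π i

open Classical in
lemma rhoLen_eq {n : ℕ} (π : Equiv.Perm (Fin n)) (k : Fin n) :
    rhoLen π k = ∑ j : Fin n, if Q π k j then 1 else 0 := by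
  unfold rhoLen
  rw [Nat.card_eq_fintype_card, Fintype.card_subtype, Finset.card_filter]
  apply Finset.sum_congr rfl
  intro j _
  simp only [Q]
  congr

/-- insert two letters at the end -/
def extFun {N : ℕ} (p : Fin (N+1)) (π : Equiv.Perm (Fin N)) : Fin (N+2) → Fin (N+2) :=
  Fin.snoc (α := fun _ => Fin (N+2))
    (Fin.snoc (α := fun _ => Fin (N+2)) (fun i => p.castSucc.succAbove (π i).castSucc) (Fin.last _))
    p.castSucc

lemma last_eq {N : ℕ} (p : Fin (N+1)) : Fin.last (N+1) = p.castSucc.succAbove (Fin.last N) := by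
  rw [Fin.succAbove_of_le_castSucc]
  · rfl
  · exact Fin.castSucc_le_castSucc_iff.2 (Fin.le_last p)

lemma extFun_inj {N : ℕ} (p : Fin (N+1)) (π : Equiv.Perm (Fin N)) :
    Function.Injective (extFun p π) := by
  unfold extFun
  rw [Fin.snoc_injective_iff, Fin.snoc_injective_iff]
  refine ⟨⟨?_, ?_⟩, ?_⟩
  · intro i j h
    simpa using h
  · rintro ⟨i, h⟩
    rw [last_eq p] at h
    simp [(Fin.castSucc_lt_last (π i)).ne] at h
  · rintro ⟨i, h⟩
    induction i using Fin.lastCases with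
    | last =>
      simp at h
      exact absurd h.symm (Fin.castSucc_lt_last p).ne
    | cast i => simp at h

noncomputable def ext {N : ℕ} (p : Fin (N+1)) (π : Equiv.Perm (Fin N)) : Equiv.Perm (Fin (N+2)) :=
  Equiv.ofBijective (extFun p π) (Finite.injective_iff_bijective.1 (extFun_inj p π))

variable {N : ℕ} (p : Fin (N+1)) (π : Equiv.Perm (Fin N))

@[simp] lemma ext_cc (i : Fin N) :
    ext p π i.castSucc.castSucc = p.castSucc.succAbove (π i).castSucc := by
  simp [ext, extFun]

@[simp] lemma ext_cl : ext p π (Fin.last N).castSucc = Fin.last (N+1) := by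
  simp [ext, extFun]

@[simp] lemma ext_l : ext p π (Fin.last (N+1)) = p.castSucc := by
  simp [ext, extFun]

lemma ext_inj : Function.Injective (ext p) := by
  intro π π' h
  ext1 i
  have := congrArg (fun f => f i.castSucc.castSucc) h
  simpa using this

lemma ext_surj (τ : Equiv.Perm (Fin (N+2))) (h1 : τ (Fin.last N).castSucc = Fin.last (N+1))
    (h2 : τ (Fin.last (N+1)) = p.castSucc) : ∃ π, ext p π = τ := by
  have key : ∀ i : Fin N, ∃ j : Fin N, p.castSucc.succAbove j.castSucc = τ i.castSucc.castSucc := by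
    intro i
    have a1 : τ i.castSucc.castSucc ≠ p.castSucc := by
      rw [← h2]; simp [Fin.ext_iff]; omega
    have a2 : τ i.castSucc.castSucc ≠ Fin.last (N+1) := by
      rw [← h1]; simp [Fin.ext_iff]; omega
    obtain ⟨j, hj⟩ := Fin.exists_succAbove_eq a1
    induction j using Fin.lastCases with
    | last => rw [← last_eq] at hj; exact absurd hj.symm a2
    | cast j => exact ⟨j, hj⟩
  choose f hf using key
  have fi : Function.Injective f := by
    intro i j h
    have : τ i.castSucc.castSucc = τ j.castSucc.castSucc := by rw [← hf, ← hf, h]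
    simpa using this
  refine ⟨Equiv.ofBijective f (Finite.injective_iff_bijective.1 fi), ?_⟩
  ext1 i
  induction i using Fin.lastCases with
  | last => simp [h2]
  | cast i =>
    induction i using Fin.lastCases with
    | last => simp [h1]
    | cast i => simp [hf]

lemma Q_cc (i j : Fin N) : Q (ext p π) i.castSucc.castSucc j.castSucc.castSucc ↔ Q π i j := by
  unfold Q
  constructor
  · rintro ⟨h, h'⟩
    refine ⟨by simpa using h, fun a ha hb => ?_⟩
    simpa using h' a.castSucc.castSucc (by simpa using ha) (by simpa using hb)
  · rintro ⟨h, h'⟩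
    refine ⟨by simpa using h, fun a ha hb => ?_⟩
    induction a using Fin.lastCases with
    | last => simp [Fin.le_def] at hb; omega
    | cast a =>
      induction a using Fin.lastCases with
      | last => simp [Fin.le_def] at hb; omega
      | cast a => simpa using h' a (by simpa using ha) (by simpa using hb)

lemma val_lt_last (i : Fin N) : p.castSucc.succAbove (π i).castSucc < Fin.last (N+1) := by
  rw [last_eq p, Fin.succAbove_lt_succAbove_iff]; exact Fin.castSucc_lt_last _

lemma val_lt_p (i : Fin N) : p.castSucc.succAbove (π i).castSucc < p.castSucc ↔ (π i : ℕ) < p := by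
  rw [Fin.succAbove_lt_iff_castSucc_lt]; simp [Fin.lt_def]

lemma Q_cl (i : Fin N) : Q (ext p π) i.castSucc.castSucc (Fin.last N).castSucc ↔
    ∀ a, i < a → π i < π a := by
  unfold Q
  constructor
  · rintro ⟨h, h'⟩ a ha
    simpa using h' a.castSucc.castSucc (by simpa using ha) (by simp [Fin.le_def])
  · intro h
    refine ⟨by simp [Fin.lt_def], fun a ha hb => ?_⟩
    induction a using Fin.lastCases with
    | last => simp [Fin.le_def] at hb
    | cast a =>
      induction a using Fin.lastCases with
      | last => simpa using val_lt_last p π i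
      | cast a => simpa using h a (by simpa using ha)

lemma Q_l (i : Fin N) : Q (ext p π) i.castSucc.castSucc (Fin.last (N+1)) ↔
    (∀ a, i < a → π i < π a) ∧ (π i : ℕ) < p := by
  rw [← Q_cl p π, ← val_lt_p]
  unfold Q
  constructor
  · rintro ⟨h, h'⟩
    refine ⟨⟨by simp [Fin.lt_def], fun a ha hb => h' a ha (Fin.le_last _)⟩, ?_⟩
    simpa using h' _ h le_rfl
  · rintro ⟨⟨h, h'⟩, h2⟩
    refine ⟨by simp [Fin.lt_def], fun a ha hb => ?_⟩
    induction a using Fin.lastCases with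
    | last => simpa using h2
    | cast a => exact h' _ ha (by simp [Fin.le_def]; omega)

open Classical in
lemma rho_cc (i : Fin N) : rhoLen (ext p π) i.castSucc.castSucc =
    rhoLen π i + (if (∀ a, i < a → π i < π a) then 1 else 0)
      + (if (∀ a, i < a → π i < π a) ∧ (π i : ℕ) < p then 1 else 0) := by
  rw [rhoLen_eq, Fin.sum_univ_castSucc, Fin.sum_univ_castSucc, rhoLen_eq]
  simp only [Q_cc, Q_cl, Q_l]

lemma rho_last {M : ℕ} (τ : Equiv.Perm (Fin (M+1))) : rhoLen τ (Fin.last M) = 0 := by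
  classical
  rw [rhoLen_eq]
  apply Finset.sum_eq_zero
  intro j _
  rw [if_neg]
  rintro ⟨h, -⟩
  exact absurd h (Fin.le_last j).not_gt

open Classical in
lemma rho_pen (τ : Equiv.Perm (Fin (N+2))) : rhoLen τ (Fin.last N).castSucc =
    if τ (Fin.last N).castSucc < τ (Fin.last (N+1)) then 1 else 0 := by
  rw [rhoLen_eq, Fin.sum_univ_castSucc, Finset.sum_eq_zero, zero_add]
  · congr 1
    apply propext
    unfold Q
    constructor
    · rintro ⟨h, h'⟩
      exact h' _ h le_rfl
    · intro h
      refine ⟨Fin.castSucc_lt_last _, fun a ha hb => ?_⟩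
      have : a = Fin.last (N+1) := by
        ext; simp [Fin.lt_def] at ha ⊢; omega
      rwa [this]
  · intro j _
    rw [if_neg]
    rintro ⟨h, -⟩
    simp [Fin.lt_def] at h
    omega


lemma lastLt_iff : lastVal π ≤ (p : ℕ) ↔ ∀ i : Fin N, (∀ a, i < a → π i < π a) → (π i : ℕ) < p := by
  unfold lastVal
  split_ifs with h
  · constructor
    · intro h' i hi
      by_cases e : i = ⟨N-1, Nat.sub_lt h Nat.one_pos⟩
      · subst e; omega
      · have := hi ⟨N-1, Nat.sub_lt h Nat.one_pos⟩ (by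
          rw [Fin.lt_def]; simp [Fin.ext_iff] at e ⊢; omega)
        rw [Fin.lt_def] at this
        omega
    · intro h'
      apply h'
      intro a ha
      rw [Fin.lt_def] at ha
      simp at ha; omega
  · constructor
    · intro _ i; exact absurd i.pos h
    · intro _; omega

lemma jacobi_iff : IsJacobi (ext p π) ↔ IsJacobi π ∧ lastVal π ≤ (p : ℕ) := by
  classical
  have hP : rhoLen (ext p π) (Fin.last N).castSucc = 0 := by
    rw [rho_pen, if_neg]; simp [Fin.le_last]
  have step : ∀ i : Fin N, ((∀ a, i < a → π i < π a) → (π i : ℕ) < p) →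
      (Even (rhoLen (ext p π) i.castSucc.castSucc) ↔ Even (rhoLen π i)) := by
    intro i hi
    rw [rho_cc]
    by_cases h : ∀ a, i < a → π i < π a
    · rw [if_pos h, if_pos ⟨h, hi h⟩]
      grind
    · rw [if_neg h, if_neg (fun h' => h h'.1)]
      simp
  constructor
  · intro hJ
    have h2 : lastVal π ≤ (p : ℕ) := by
      by_cases hN : 0 < N
      · have := hJ (Fin.castSucc (Fin.castSucc ⟨N-1, Nat.sub_lt hN Nat.one_pos⟩))
        have hall : ∀ a : Fin N, (⟨N-1, Nat.sub_lt hN Nat.one_pos⟩ : Fin N) < a →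
            π ⟨N-1, Nat.sub_lt hN Nat.one_pos⟩ < π a := by
          intro a ha
          rw [Fin.lt_def] at ha
          simp at ha; omega
        have h0 : rhoLen π ⟨N-1, Nat.sub_lt hN Nat.one_pos⟩ = 0 := by
          rw [rhoLen_eq]
          apply Finset.sum_eq_zero
          intro j _
          rw [if_neg]
          rintro ⟨h, -⟩
          rw [Fin.lt_def] at h
          simp at h; omega
        rw [rho_cc, if_pos hall, h0] at this
        unfold lastVal
        rw [dif_pos hN]
        by_contra hc
        rw [if_neg (fun h' => hc h'.2)] at this
        simp at this
      · unfold lastVal; simp [hN]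
    refine ⟨fun i => ?_, h2⟩
    exact (step i ((lastLt_iff p π).1 h2 i)).1 (hJ _)
  · rintro ⟨hJ, h2⟩ i
    induction i using Fin.lastCases with
    | last => rw [rho_last]; simp
    | cast i =>
      induction i using Fin.lastCases with
      | last => rw [hP]; simp
      | cast i => exact (step i ((lastLt_iff p π).1 h2 i)).2 (hJ i)

lemma avoid_of_ext (h : Avoids321 (ext p π)) : Avoids321 π := by
  rintro ⟨i, j, k, hij, hjk, h1, h2⟩
  exact h ⟨i.castSucc.castSucc, j.castSucc.castSucc, k.castSucc.castSucc, by simpa, by simpa,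
    by simpa, by simpa⟩

lemma avoid_ext (h : Avoids321 π) (hl : lastVal π ≤ (p : ℕ)) : Avoids321 (ext p π) := by
  rintro ⟨i, j, k, hij, hjk, h1, h2⟩
  induction j using Fin.lastCases with
  | last => exact absurd hjk (Fin.le_last k).not_gt
  | cast j =>
  induction i using Fin.lastCases with
  | last => exact absurd hij (Fin.le_last _).not_gt
  | cast i =>
  induction j using Fin.lastCases with
  | last =>
    rw [ext_cl] at h2
    exact absurd h2 (Fin.le_last _).not_gt
  | cast j =>
  induction i using Fin.lastCases with
  | last => simp [Fin.lt_def] at hij; omega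
  | cast i =>
  simp at h2 hij
  induction k using Fin.lastCases with
  | last =>
    rw [ext_l, ext_cc] at h1
    have hp : ¬ ((π j : ℕ) < p) := by
      rw [← val_lt_p]; exact h1.not_gt
    have hN : 0 < N := j.pos
    unfold lastVal at hl
    rw [dif_pos hN] at hl
    refine h ⟨i, j, ⟨N-1, Nat.sub_lt hN Nat.one_pos⟩, hij, ?_, ?_, h2⟩
    · rw [Fin.lt_def]
      have : j ≠ ⟨N-1, Nat.sub_lt hN Nat.one_pos⟩ := by
        rintro rfl; omega
      simp [Fin.ext_iff] at this ⊢; omega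
    · rw [Fin.lt_def]; omega
  | cast k =>
  induction k using Fin.lastCases with
  | last =>
    rw [ext_cl] at h1
    exact absurd h1 (Fin.le_last _).not_gt
  | cast k =>
    simp at h1 hjk
    exact h ⟨i, j, k, hij, hjk, h1, h2⟩

lemma lastVal_succ {M : ℕ} (τ : Equiv.Perm (Fin (M+1))) :
    lastVal τ = (τ (Fin.last M) : ℕ) + 1 := by
  unfold lastVal
  rw [dif_pos (Nat.succ_pos _)]
  rfl

lemma pen_max (τ : Equiv.Perm (Fin (N+2))) (hJ : IsJacobi τ) (hA : Avoids321 τ) :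
    τ (Fin.last N).castSucc = Fin.last (N+1) := by
  classical
  have h := hJ (Fin.last N).castSucc
  rw [rho_pen] at h
  split_ifs at h with hc
  · simp at h
  have hne : τ (Fin.last N).castSucc ≠ τ (Fin.last (N+1)) := by
    simp [Fin.ext_iff]
  have hlt : τ (Fin.last (N+1)) < τ (Fin.last N).castSucc := lt_of_le_of_ne (not_lt.1 hc) hne.symm
  by_contra hm
  obtain ⟨j, hj⟩ := τ.surjective (Fin.last (N+1))
  have hm' : τ (Fin.last N).castSucc < τ j := by
    rw [hj]; exact lt_of_le_of_ne (Fin.le_last _) hm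
  refine hA ⟨j, (Fin.last N).castSucc, Fin.last (N+1), ?_, Fin.castSucc_lt_last _, hlt, hm'⟩
  rw [Fin.lt_def]
  have b1 : j ≠ (Fin.last N).castSucc := by rintro rfl; exact absurd hm' (lt_irrefl _)
  have b2 : j ≠ Fin.last (N+1) := by rintro rfl; exact absurd (hm'.trans hlt) (lt_irrefl _)
  simp [Fin.ext_iff] at b1 b2 ⊢
  omega

noncomputable def a (N k : ℕ) : ℕ :=
  Nat.card {π : Equiv.Perm (Fin N) // IsJacobi π ∧ Avoids321 π ∧ lastVal π = k}

lemma a_zero (k : ℕ) : a 0 k = if k = 0 then 1 else 0 := by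
  unfold a
  split_ifs with h
  · rw [Nat.card_eq_one_iff_unique]
    refine ⟨⟨fun x y => Subtype.ext (Subsingleton.elim _ _)⟩, ⟨⟨1, fun i => i.elim0, ?_, ?_⟩⟩⟩
    · rintro ⟨i, -⟩; exact i.elim0
    · simp [lastVal, h]
  · rw [Nat.card_eq_zero]
    left
    refine ⟨?_⟩
    rintro ⟨π, -, -, h'⟩
    simp [lastVal] at h'
    omega

lemma a_one (k : ℕ) : a 1 k = if k = 1 then 1 else 0 := by
  unfold a
  split_ifs with h
  · rw [Nat.card_eq_one_iff_unique]
    refine ⟨⟨fun x y => Subtype.ext (Subsingleton.elim _ _)⟩, ⟨⟨1, fun i => ?_, ?_, ?_⟩⟩⟩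
    · rw [Subsingleton.elim i (Fin.last 0), rho_last]; simp
    · rintro ⟨i, j, k, h, -⟩
      exact absurd h (by rw [Subsingleton.elim i j]; exact lt_irrefl _)
    · simp [lastVal, h]
  · rw [Nat.card_eq_zero]
    left
    refine ⟨?_⟩
    rintro ⟨π, -, -, h'⟩
    rw [lastVal_succ] at h'
    omega

lemma a_succ_zero (M : ℕ) : a (M+1) 0 = 0 := by
  unfold a
  rw [Nat.card_eq_zero]
  left
  refine ⟨?_⟩
  rintro ⟨π, -, -, h'⟩
  rw [lastVal_succ] at h'
  omega

lemma card_lt (N k : ℕ) :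
    Nat.card {π : Equiv.Perm (Fin N) // IsJacobi π ∧ Avoids321 π ∧ lastVal π < k}
      = ∑ l ∈ range k, a N l := by
  classical
  unfold a
  simp only [Nat.card_eq_fintype_card, Fintype.card_subtype]
  rw [Finset.card_eq_sum_card_fiberwise (f := lastVal) (t := range k)]
  · apply Finset.sum_congr rfl
    intro l hl
    congr 1
    ext π
    simp at hl ⊢
    constructor
    · rintro ⟨⟨h1, h2, h3⟩, h4⟩; exact ⟨h1, h2, h4⟩
    · rintro ⟨h1, h2, h4⟩; exact ⟨⟨h1, h2, by omega⟩, h4⟩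
  · intro π h
    simp at h ⊢
    exact h.2.2

lemma a_rec (N k : ℕ) : a (N+2) k = if k ≤ N + 1 then ∑ l ∈ range k, a N l else 0 := by
  rcases k with _ | k
  · simp [a_succ_zero]
  split_ifs with h
  · rw [← card_lt]
    symm
    let p : Fin (N+1) := ⟨k, by omega⟩
    apply Nat.card_congr
    refine Equiv.ofBijective
      (fun x => ⟨ext p x.1, (jacobi_iff p x.1).2 ⟨x.2.1, ?_⟩, avoid_ext p x.1 x.2.2.1 ?_, ?_⟩) ⟨?_, ?_⟩
    · have := x.2.2.2; simp [p]; omega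
    · have := x.2.2.2; simp [p]; omega
    · rw [lastVal_succ, ext_l]; simp [p]
    · intro x y hxy
      simp only [Subtype.mk.injEq] at hxy
      exact Subtype.ext (ext_inj p hxy)
    · rintro ⟨τ, hJ, hA, hl⟩
      obtain ⟨π, rfl⟩ := ext_surj p τ (pen_max τ hJ hA) (by
        rw [lastVal_succ] at hl
        ext; simp [p]; omega)
      have := (jacobi_iff p π).1 hJ
      refine ⟨⟨π, this.1, avoid_of_ext p π hA, ?_⟩, rfl⟩
      have := this.2
      simp [p] at this
      omega
  · unfold a
    rw [Nat.card_eq_zero]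
    left
    refine ⟨?_⟩
    rintro ⟨π, h1, h2, h'⟩
    rw [lastVal_succ] at h'
    have e := pen_max π h1 h2
    have : π (Fin.last (N+1)) ≠ Fin.last (N+1) := by
      intro h3
      have := π.injective (h3.trans e.symm)
      simp [Fin.ext_iff] at this
    simp [Fin.ext_iff] at this
    omega

lemma closed_sum (n : ℕ) (hn : 1 ≤ n) (k : ℕ) :
    ∑ l ∈ range k, ((2 * n - (l + 1 : ℚ)) / n * (l.choose (n-1) : ℕ))
      = (2 * (n + 1) - (k + 1 : ℚ)) / (n + 1) * (k.choose n : ℕ) := by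
  obtain ⟨m, rfl⟩ : ∃ m, n = m + 1 := ⟨n - 1, by omega⟩
  induction k with
  | zero => simp
  | succ k ih =>
    rw [Finset.sum_range_succ, ih]
    have h1 : (((k+1).choose (m+1) : ℕ) : ℚ) = k.choose m + k.choose (m+1) := by
      rw [Nat.choose_succ_succ]; push_cast; rfl
    have h2 : ((k.choose (m+1) : ℕ) : ℚ) * (m + 1) = (k - m) * k.choose m := by
      rcases le_or_gt m k with h | h
      · have := Nat.choose_succ_right_eq k m
        have h3 : ((k - m : ℕ) : ℚ) = k - m := by push_cast [h]; rfl
        rw [← h3]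
        rw [mul_comm (((k - m : ℕ) : ℚ))]
        exact_mod_cast this
      · rw [Nat.choose_eq_zero_of_lt h, Nat.choose_eq_zero_of_lt (by omega)]; simp
    have h4 : ((k.choose (m+1) : ℕ) : ℚ) = (k - m) * k.choose m / (m+1) := by
      rw [← h2]; field_simp
    rw [h1, h4]
    simp only [Nat.add_sub_cancel]
    push_cast
    have : (m + 1 + 1 : ℚ) ≠ 0 := by positivity
    field_simp
    ring

lemma closed (A : ℕ → ℕ → ℕ) (h0 : ∀ k, A 0 k = if k = 0 then 1 else 0)
    (hr : ∀ n k, A (n+1) k = if k ≤ 2 * n + 1 then ∑ l ∈ range k, A n l else 0)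
    (n : ℕ) : A (n+1) 0 = 0 ∧ (∀ k, k < 2 * n + 2 → (A (n+1) (k+1) : ℚ)
      = (2 * (n + 1) - (k + 1 : ℚ)) / (n + 1) * (k.choose n : ℕ)) ∧ ∀ k, 2 * n + 2 ≤ k → A (n+1) k = 0 := by
  refine ⟨by simp [hr], ?_, fun k hk => by rw [hr, if_neg (by omega)]⟩
  induction n with
  | zero =>
    intro k hk
    rw [hr]
    interval_cases k <;> simp [h0] <;> norm_num
  | succ n ih =>
    intro k hk
    rw [hr]
    have hz : A (n+1) 0 = 0 := by simp [hr]
    split_ifs with h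
    · rw [Finset.sum_range_succ', hz, add_zero]
      have := closed_sum (n+1) (by omega) k
      push_cast at this ⊢
      rw [← this]
      apply Finset.sum_congr rfl
      intro l hl
      rw [ih l (by simp at hl; omega)]
    · have : k = 2 * n + 3 := by omega
      subst this
      push_cast
      have : (2 * ((n:ℚ) + 1 + 1) - (2 * n + 3 + 1)) = 0 := by ring
      rw [this]; simp

lemma closed' (A : ℕ → ℕ → ℕ) (h0 : ∀ k, A 0 k = if k = 0 then 1 else 0)
    (hr : ∀ n k, A (n+1) k = if k ≤ 2 * n + 1 then ∑ l ∈ range k, A n l else 0)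
    (n : ℕ) (hn : 1 ≤ n) (k : ℕ) : (A n k : ℚ) = if n ≤ k ∧ k ≤ 2 * n - 1 then
          (((2 * n - k : ℕ) : ℚ) / (n : ℚ)) * ((k - 1).choose (n - 1) : ℕ)
        else 0 := by
  obtain ⟨m, rfl⟩ : ∃ m, n = m + 1 := ⟨n - 1, by omega⟩
  obtain ⟨c1, c2, c3⟩ := closed A h0 hr m
  rcases k with _ | k
  · simp [c1]
  rcases le_or_gt (2 * m + 2) (k+1) with hk | hk
  · rw [c3 _ hk, if_neg (by omega)]; simp
  rw [c2 k (by omega)]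
  split_ifs with h
  · have : ((2 * (m+1) - (k+1) : ℕ) : ℚ) = 2 * (m+1) - (k+1) := by
      rw [Nat.cast_sub (by omega)]; push_cast; ring
    rw [this]
    simp
  · rw [Nat.choose_eq_zero_of_lt (by omega)]; simp

end JacAux

/-- Counting 321-avoiding Jacobi permutations by the last letter. -/
theorem jacobi_avoid_321_last (n : ℕ) (hn : 1 ≤ n) (k : ℕ) :
    (Nat.card {π : Equiv.Perm (Fin (2 * n)) //
        IsJacobi π ∧ Avoids321 π ∧ lastVal π = k} : ℚ)
      = (if n ≤ k ∧ k ≤ 2 * n - 1 then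
          (((2 * n - k : ℕ) : ℚ) / (n : ℚ)) * ((k - 1).choose (n - 1) : ℕ)
        else 0) ∧
    (Nat.card {π : Equiv.Perm (Fin (2 * n + 1)) //
        IsJacobi π ∧ Avoids321 π ∧ lastVal π = k} : ℚ)
      = (if n + 1 ≤ k ∧ k ≤ 2 * n then
          (((2 * n - k + 1 : ℕ) : ℚ) / (n : ℚ)) * ((k - 2).choose (n - 1) : ℕ)
        else 0) := by
  classical
  refine ⟨JacAux.closed' (fun n k => JacAux.a (2 * n) k) JacAux.a_zero
    (fun n k => JacAux.a_rec (2 * n) k) n hn k, ?_⟩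
  change (JacAux.a (2 * n + 1) k : ℚ) = _
  rcases k with _ | k
  · simp [JacAux.a_succ_zero]
  have := JacAux.closed' (fun n k => JacAux.a (2 * n + 1) (k + 1)) (fun k => by simp [JacAux.a_one])
    (fun n k => by
      show JacAux.a (2 * n + 1 + 2) (k + 1) = _
      rw [JacAux.a_rec, Finset.sum_range_succ', JacAux.a_succ_zero]
      simp) n hn k
  rw [this]
  by_cases h : n ≤ k ∧ k ≤ 2 * n - 1
  · rw [if_pos h, if_pos (by omega), show 2 * n - (k + 1) + 1 = 2 * n - k by omega,
      show k + 1 - 2 = k - 1 by omega]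
  · rw [if_neg h, if_neg (by omega)]
end

section
/- For all n ≥ 1, the number of Jacobi permutations of [n] avoiding both patterns 123 and 213 equals the Fibonacci number f_{n−1}, where f₀ = f₁ = 1 and f_n = f_{n−1} + f_{n−2} for n ≥ 2. -/
theorem rhoLen_eq_sum {n : ℕ} (π : Equiv.Perm (Fin n)) (k : Fin n) :
    rhoLen π k = ∑ j : Fin n,
      if (k < j ∧ ∀ i : Fin n, k < i → i ≤ j → π k < π i) then 1 else 0 := by
  unfold rhoLen
  rw [Nat.card_eq_fintype_card, Fintype.card_subtype, Finset.card_filter]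

/-- The combined property being counted. -/
def GoodPerm {n : ℕ} (π : Equiv.Perm (Fin n)) : Prop :=
  IsJacobi π ∧ Avoids123 π ∧ Avoids213 π

/-- The underlying function of `addTop`. -/
def addTopFun {n : ℕ} (π : Equiv.Perm (Fin n)) : Fin (n + 1) → Fin (n + 1) :=
  Fin.cons (Fin.last n) (fun i => (π i).castSucc)

theorem addTopFun_injective {n : ℕ} (π : Equiv.Perm (Fin n)) :
    Function.Injective (addTopFun π) := by
  unfold addTopFun
  rw [Fin.cons_injective_iff]
  refine ⟨?_, ?_⟩
  · rintro ⟨i, hi⟩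
    exact (Fin.castSucc_lt_last (π i)).ne hi
  · intro i j h
    simpa using h

/-- Prepend the maximal letter. -/
noncomputable def addTop {n : ℕ} (π : Equiv.Perm (Fin n)) : Equiv.Perm (Fin (n + 1)) :=
  Equiv.ofBijective (addTopFun π) (Finite.injective_iff_bijective.mp (addTopFun_injective π))

theorem addTop_zero {n : ℕ} (π : Equiv.Perm (Fin n)) : addTop π 0 = Fin.last n := rfl

theorem addTop_succ {n : ℕ} (π : Equiv.Perm (Fin n)) (i : Fin n) :
    addTop π i.succ = (π i).castSucc := rfl

/-- The underlying function of `addTwo`. -/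
def addTwoFun {n : ℕ} (π : Equiv.Perm (Fin (n + 1))) : Fin (n + 3) → Fin (n + 3) :=
  Fin.cons (π 0).castSucc.castSucc (Fin.cons (Fin.last (n + 2))
    (Fin.cons (Fin.last (n + 1)).castSucc (fun i => (π i.succ).castSucc.castSucc)))

theorem addTwoFun_injective {n : ℕ} (π : Equiv.Perm (Fin (n + 1))) :
    Function.Injective (addTwoFun π) := by
  have h1 : ∀ x : Fin (n + 1), x.castSucc.castSucc ≠ Fin.last (n + 2) := fun x =>
    (Fin.castSucc_lt_last _).ne
  have h2 : ∀ x : Fin (n + 1), x.castSucc.castSucc ≠ (Fin.last (n + 1)).castSucc := fun x h =>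
    (Fin.castSucc_lt_last x).ne (Fin.castSucc_injective _ h)
  have h3 : (Fin.last (n + 1)).castSucc ≠ Fin.last (n + 2) := (Fin.castSucc_lt_last _).ne
  unfold addTwoFun
  rw [Fin.cons_injective_iff, Fin.cons_injective_iff, Fin.cons_injective_iff]
  refine ⟨?_, ?_, ?_, ?_⟩
  · rintro ⟨i, hi⟩
    induction i using Fin.cases with
    | zero => exact h1 _ hi.symm
    | succ i =>
      induction i using Fin.cases with
      | zero => exact h2 _ hi.symm
      | succ i =>
        have := π.injective (Fin.castSucc_injective _ (Fin.castSucc_injective _ hi))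
        exact Fin.succ_ne_zero _ this
  · rintro ⟨i, hi⟩
    induction i using Fin.cases with
    | zero => exact h3 hi
    | succ i => exact h1 _ hi
  · rintro ⟨i, hi⟩
    exact h2 _ hi
  · intro i j h
    simpa using h

/-- Insert the two maximal letters, in decreasing order, after the first letter. -/
noncomputable def addTwo {n : ℕ} (π : Equiv.Perm (Fin (n + 1))) : Equiv.Perm (Fin (n + 3)) :=
  Equiv.ofBijective (addTwoFun π) (Finite.injective_iff_bijective.mp (addTwoFun_injective π))

theorem addTwo_zero {n : ℕ} (π : Equiv.Perm (Fin (n + 1))) :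
    addTwo π 0 = (π 0).castSucc.castSucc := rfl

theorem addTwo_one {n : ℕ} (π : Equiv.Perm (Fin (n + 1))) :
    addTwo π (Fin.succ 0) = Fin.last (n + 2) := rfl

theorem addTwo_two {n : ℕ} (π : Equiv.Perm (Fin (n + 1))) :
    addTwo π (Fin.succ (Fin.succ 0)) = (Fin.last (n + 1)).castSucc := rfl

theorem addTwo_succ {n : ℕ} (π : Equiv.Perm (Fin (n + 1))) (i : Fin n) :
    addTwo π i.succ.succ.succ = (π i.succ).castSucc.castSucc := rfl

theorem rhoLen_addTop_zero {n : ℕ} (π : Equiv.Perm (Fin n)) : rhoLen (addTop π) 0 = 0 := by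
  rw [rhoLen_eq_sum]
  apply Finset.sum_eq_zero
  intro j _
  rw [if_neg]
  rintro ⟨h1, h2⟩
  exact absurd (h2 j h1 le_rfl) (not_lt.mpr (Fin.le_last _))

theorem rhoLen_addTop_succ {n : ℕ} (π : Equiv.Perm (Fin n)) (k : Fin n) :
    rhoLen (addTop π) k.succ = rhoLen π k := by
  rw [rhoLen_eq_sum, rhoLen_eq_sum, Fin.sum_univ_succ]
  simp [Fin.forall_fin_succ, addTop_zero, addTop_succ]

theorem rhoLen_addTwo_zero {n : ℕ} (π : Equiv.Perm (Fin (n + 1))) :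
    rhoLen (addTwo π) 0 = rhoLen π 0 + 2 := by
  have h3 : (π 0).castSucc.castSucc < (Fin.last (n + 1)).castSucc := Fin.castSucc_lt_last (π 0)
  rw [rhoLen_eq_sum, rhoLen_eq_sum, Fin.sum_univ_succ, Fin.sum_univ_succ, Fin.sum_univ_succ,
    Fin.sum_univ_succ]
  simp only [Fin.forall_fin_succ, addTwo_zero, addTwo_one, addTwo_two, addTwo_succ]
  simp [Fin.castSucc_lt_last, h3, Fin.succ_le_succ_iff,
    -Fin.succ_zero_eq_one, -Fin.succ_zero_eq_one', -Fin.succ_one_eq_two, -Fin.succ_one_eq_two']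
  omega

theorem rhoLen_addTwo_one {n : ℕ} (π : Equiv.Perm (Fin (n + 1))) :
    rhoLen (addTwo π) (Fin.succ 0) = 0 := by
  rw [rhoLen_eq_sum]
  apply Finset.sum_eq_zero
  intro j _
  rw [if_neg]
  rintro ⟨h1, h2⟩
  exact absurd (h2 j h1 le_rfl) (not_lt.mpr (Fin.le_last _))

theorem rhoLen_addTwo_two {n : ℕ} (π : Equiv.Perm (Fin (n + 1))) :
    rhoLen (addTwo π) (Fin.succ (Fin.succ 0)) = 0 := by
  rw [rhoLen_eq_sum]
  apply Finset.sum_eq_zero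
  intro j _
  rw [if_neg]
  rintro ⟨h1, h2⟩
  have h := h2 j h1 le_rfl
  induction j using Fin.cases with
  | zero => exact absurd h1 (Fin.not_lt_zero _)
  | succ j =>
    induction j using Fin.cases with
    | zero => exact absurd (Fin.succ_lt_succ_iff.mp h1) (Fin.not_lt_zero _)
    | succ j =>
      induction j using Fin.cases with
      | zero => exact lt_irrefl _ h1
      | succ j =>
        rw [addTwo_two, addTwo_succ] at h
        exact absurd h (not_lt.mpr (Fin.castSucc_lt_last (π j.succ)).le)

theorem rhoLen_addTwo_succ {n : ℕ} (π : Equiv.Perm (Fin (n + 1))) (k : Fin n) :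
    rhoLen (addTwo π) k.succ.succ.succ = rhoLen π k.succ := by
  rw [rhoLen_eq_sum, rhoLen_eq_sum, Fin.sum_univ_succ, Fin.sum_univ_succ, Fin.sum_univ_succ,
    Fin.sum_univ_succ]
  simp only [Fin.forall_fin_succ, addTwo_zero, addTwo_one, addTwo_two, addTwo_succ]
  simp [-Fin.succ_zero_eq_one, -Fin.succ_zero_eq_one', -Fin.succ_one_eq_two, -Fin.succ_one_eq_two']

theorem goodPerm_addTop {n : ℕ} (π : Equiv.Perm (Fin n)) : GoodPerm (addTop π) ↔ GoodPerm π := by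
  have hl : ∀ x : Fin (n + 1), ¬ Fin.last n < x := fun x => not_lt.mpr (Fin.le_last x)
  unfold GoodPerm
  refine and_congr ?_ (and_congr ?_ ?_)
  · simp [IsJacobi, Fin.forall_fin_succ, rhoLen_addTop_zero, rhoLen_addTop_succ]
  · simp [Avoids123, Fin.forall_fin_succ, addTop_zero, addTop_succ, hl, Fin.le_last]
  · simp [Avoids213, Fin.forall_fin_succ, addTop_zero, addTop_succ, hl, Fin.le_last]

theorem goodPerm_addTwo {n : ℕ} (π : Equiv.Perm (Fin (n + 1))) :
    GoodPerm (addTwo π) ↔ GoodPerm π := by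
  have hl : ∀ x : Fin (n + 3), ¬ Fin.last (n + 2) < x := fun x => not_lt.mpr (Fin.le_last x)
  have hl' : ∀ x : Fin (n + 1), ¬ (Fin.last (n + 1)).castSucc < x.castSucc.castSucc := fun x =>
    not_lt.mpr (Fin.castSucc_lt_last x).le
  unfold GoodPerm
  refine and_congr ?_ (and_congr ?_ ?_)
  · simp only [IsJacobi, Fin.forall_fin_succ, rhoLen_addTwo_zero, rhoLen_addTwo_one,
      rhoLen_addTwo_two, rhoLen_addTwo_succ]
    simp [Nat.even_add]
  · simp only [Avoids123, not_exists, Fin.forall_fin_succ, addTwo_zero, addTwo_one, addTwo_two,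
      addTwo_succ]
    simp [hl, hl', Fin.le_last,
      -Fin.succ_zero_eq_one, -Fin.succ_zero_eq_one', -Fin.succ_one_eq_two, -Fin.succ_one_eq_two']
  · simp only [Avoids213, not_exists, Fin.forall_fin_succ, addTwo_zero, addTwo_one, addTwo_two,
      addTwo_succ]
    simp [hl, hl', Fin.le_last,
      -Fin.succ_zero_eq_one, -Fin.succ_zero_eq_one', -Fin.succ_one_eq_two, -Fin.succ_one_eq_two']

theorem goodPerm_cases {n : ℕ} (π : Equiv.Perm (Fin (n + 3))) (h : GoodPerm π) :
    π 0 = Fin.last (n + 2) ∨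
      (π (Fin.succ 0) = Fin.last (n + 2) ∧
        π (Fin.succ (Fin.succ 0)) = (Fin.last (n + 1)).castSucc) := by
  obtain ⟨hJ, h1, h2⟩ := h
  -- at most one smaller letter precedes each letter
  have key : ∀ i j k : Fin (n + 3), i < j → j < k → π i < π k → ¬ π j < π k := by
    intro i j k hij hjk hik hjk'
    rcases lt_trichotomy (π i) (π j) with h | h | h
    · exact h1 ⟨i, j, k, hij, hjk, h, hjk'⟩
    · exact hij.ne (π.injective h)
    · exact h2 ⟨i, j, k, hij, hjk, h, hik⟩
  by_cases h0 : π 0 = Fin.last (n + 2)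
  · exact Or.inl h0
  right
  have inj := π.injective
  have hone : π (Fin.succ 0) = Fin.last (n + 2) := by
    obtain ⟨m, hm⟩ := π.surjective (Fin.last (n + 2))
    induction m using Fin.cases with
    | zero => exact absurd hm h0
    | succ m =>
      induction m using Fin.cases with
      | zero => exact hm
      | succ m =>
        exfalso
        refine key 0 (Fin.succ 0) m.succ.succ (Fin.succ_pos _) (Fin.succ_lt_succ_iff.mpr (Fin.succ_pos _)) ?_ ?_
        · rw [hm]; exact Fin.lt_last_iff_ne_last.mpr h0
        · rw [hm]; apply Fin.lt_last_iff_ne_last.mpr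
          intro h
          have := inj (h.trans hm.symm)
          have := congrArg Fin.val this
          simp only [Fin.val_succ, Fin.val_zero] at this
          omega
  refine ⟨hone, ?_⟩
  have h02 : π 0 < π (Fin.succ (Fin.succ 0)) := by
    by_contra hlt
    have hE := hJ 0
    have : rhoLen π 0 = 1 := by
      rw [rhoLen_eq_sum, Fin.sum_univ_succ, Fin.sum_univ_succ]
      rw [if_neg (by simp), if_pos, Finset.sum_eq_zero, zero_add, add_zero]
      · intro j _
        rw [if_neg]
        rintro ⟨-, hj⟩
        exact hlt (hj (Fin.succ (Fin.succ 0)) (Fin.succ_pos _)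
          (Fin.succ_le_succ_iff.mpr (Fin.succ_le_succ_iff.mpr (Fin.zero_le _))))
      · refine ⟨by simp, ?_⟩
        intro i hi hi'
        have : i = Fin.succ 0 := by
          apply le_antisymm hi'
          rw [Fin.lt_def] at hi
          rw [Fin.le_def]
          simp only [Fin.val_succ, Fin.val_zero] at hi ⊢
          omega
        rw [this, hone]
        exact Fin.lt_last_iff_ne_last.mpr h0
    rw [this] at hE
    exact absurd hE (by decide)
  have lt_of : ∀ i, i ≠ Fin.succ 0 → π i ≠ (Fin.last (n + 1)).castSucc →
      π i < (Fin.last (n + 1)).castSucc := by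
    intro i hi hne
    have : π i ≠ Fin.last (n + 2) := fun h => hi (inj (h.trans hone.symm))
    simp [Fin.lt_def, Fin.ext_iff] at this hne ⊢
    have := (π i).isLt
    omega
  obtain ⟨m, hm⟩ := π.surjective (Fin.last (n + 1)).castSucc
  induction m using Fin.cases with
  | zero =>
    exfalso
    rw [hm] at h02
    have : π (Fin.succ (Fin.succ 0)) ≠ Fin.last (n + 2) := by
      intro h
      have := inj (h.trans hone.symm)
      have := congrArg Fin.val this
      simp only [Fin.val_succ, Fin.val_zero] at this
      omega
    simp [Fin.lt_def, Fin.ext_iff] at this h02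
    have := (π (Fin.succ (Fin.succ 0))).isLt
    simp at this
    omega
  | succ m =>
    induction m using Fin.cases with
    | zero =>
      rw [hone] at hm
      exact absurd hm.symm (Fin.castSucc_lt_last _).ne
    | succ m =>
      induction m using Fin.cases with
      | zero => exact hm
      | succ m =>
        exfalso
        refine key 0 (Fin.succ (Fin.succ 0)) m.succ.succ.succ (Fin.succ_pos _)
          (Fin.succ_lt_succ_iff.mpr (Fin.succ_lt_succ_iff.mpr (Fin.succ_pos _))) ?_ ?_
        · rw [hm]
          refine lt_of _ (by rw [Ne, Fin.ext_iff]; simp only [Fin.val_succ, Fin.val_zero]; omega) ?_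
          intro h
          have := inj (h.trans hm.symm)
          have := congrArg Fin.val this
          simp only [Fin.val_succ, Fin.val_zero] at this
          omega
        · rw [hm]
          refine lt_of _ (by rw [Ne, Fin.ext_iff]; simp only [Fin.val_succ, Fin.val_zero]; omega) ?_
          intro h
          have := inj (h.trans hm.symm)
          have := congrArg Fin.val this
          simp only [Fin.val_succ, Fin.val_zero] at this
          omega

theorem addTop_injective {n : ℕ} : Function.Injective (addTop (n := n)) := by
  intro σ τ h
  ext1 i
  have := congrArg (fun p => p i.succ) h
  simpa [addTop_succ] using this

theorem addTwo_injective {n : ℕ} : Function.Injective (addTwo (n := n)) := by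
  intro σ τ h
  ext1 i
  induction i using Fin.cases with
  | zero =>
    have := congrArg (fun p => p 0) h
    simpa only [addTwo_zero, Fin.castSucc_inj] using this
  | succ i =>
    have := congrArg (fun p => p i.succ.succ.succ) h
    simpa only [addTwo_succ, Fin.castSucc_inj] using this

theorem exists_addTop {n : ℕ} (π : Equiv.Perm (Fin (n + 1))) (h : π 0 = Fin.last n) :
    ∃ σ, addTop σ = π := by
  have hne : ∀ i : Fin n, π i.succ ≠ Fin.last n := fun i hi =>
    Fin.succ_ne_zero i (π.injective (hi.trans h.symm))
  have hinj : Function.Injective (fun i : Fin n => (π i.succ).castPred (hne i)) := by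
    intro i j hij
    simpa [Fin.castPred_inj] using hij
  refine ⟨Equiv.ofBijective _ (Finite.injective_iff_bijective.mp hinj), ?_⟩
  ext1 i
  induction i using Fin.cases with
  | zero => rw [addTop_zero, h]
  | succ i => simp [addTop_succ]

theorem exists_addTwo {n : ℕ} (π : Equiv.Perm (Fin (n + 3)))
    (h1 : π (Fin.succ 0) = Fin.last (n + 2))
    (h2 : π (Fin.succ (Fin.succ 0)) = (Fin.last (n + 1)).castSucc) :
    ∃ σ, addTwo σ = π := by
  have hlt : ∀ i, i ≠ Fin.succ 0 → i ≠ Fin.succ (Fin.succ 0) → (π i : ℕ) < n + 1 := by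
    intro i hi hi'
    have a1 : π i ≠ Fin.last (n + 2) := fun h => hi (π.injective (h.trans h1.symm))
    have a2 : π i ≠ (Fin.last (n + 1)).castSucc := fun h => hi' (π.injective (h.trans h2.symm))
    have := (π i).isLt
    simp [Fin.ext_iff] at a1 a2
    omega
  let g : Fin (n + 1) → Fin (n + 1) := Fin.cons
    ⟨π 0, hlt 0 (by rw [Ne, Fin.ext_iff]; simp only [Fin.val_succ, Fin.val_zero]; omega) (by rw [Ne, Fin.ext_iff]; simp only [Fin.val_succ, Fin.val_zero]; omega)⟩
    (fun i => ⟨π i.succ.succ.succ, hlt _ (by rw [Ne, Fin.ext_iff]; simp only [Fin.val_succ, Fin.val_zero]; omega) (by rw [Ne, Fin.ext_iff]; simp only [Fin.val_succ, Fin.val_zero]; omega)⟩)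
  have hinj : Function.Injective g := by
    rw [Fin.cons_injective_iff]
    constructor
    · rintro ⟨i, hi⟩
      have hv : (π i.succ.succ.succ : ℕ) = π 0 := Fin.mk.inj hi
      have := π.injective (Fin.ext hv)
      exact Fin.succ_ne_zero _ this
    · intro i j hij
      have hv : (π i.succ.succ.succ : ℕ) = π j.succ.succ.succ := by
        exact Fin.mk.inj hij
      have := π.injective (Fin.ext hv)
      simpa using this
  refine ⟨Equiv.ofBijective g (Finite.injective_iff_bijective.mp hinj), ?_⟩
  ext1 i
  induction i using Fin.cases with
  | zero => rfl
  | succ i =>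
    induction i using Fin.cases with
    | zero => rw [addTwo_one, h1]
    | succ i =>
      induction i using Fin.cases with
      | zero => rw [addTwo_two, h2]
      | succ i => rfl

/-- The recursive decomposition. -/
noncomputable def goodMap (n : ℕ) :
    {π : Equiv.Perm (Fin (n + 2)) // GoodPerm π} ⊕ {π : Equiv.Perm (Fin (n + 1)) // GoodPerm π} →
      {π : Equiv.Perm (Fin (n + 3)) // GoodPerm π} :=
  Sum.elim (fun σ => ⟨addTop σ.1, (goodPerm_addTop _).mpr σ.2⟩)
    (fun σ => ⟨addTwo σ.1, (goodPerm_addTwo _).mpr σ.2⟩)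

theorem addTop_ne_addTwo {n : ℕ} (σ : Equiv.Perm (Fin (n + 2))) (τ : Equiv.Perm (Fin (n + 1))) :
    addTop σ ≠ addTwo τ := by
  intro h
  have := congrArg (fun p => p 0) h
  simp only [addTop_zero, addTwo_zero] at this
  exact (Fin.castSucc_lt_last _).ne this.symm

theorem goodMap_bijective (n : ℕ) : Function.Bijective (goodMap n) := by
  constructor
  · rintro (σ | σ) (τ | τ) h
    · exact congrArg _ (Subtype.ext (addTop_injective (Subtype.ext_iff.mp h)))
    · exact absurd (Subtype.ext_iff.mp h) (addTop_ne_addTwo _ _)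
    · exact absurd (Subtype.ext_iff.mp h).symm (addTop_ne_addTwo _ _)
    · exact congrArg _ (Subtype.ext (addTwo_injective (Subtype.ext_iff.mp h)))
  · rintro ⟨π, hπ⟩
    rcases goodPerm_cases π hπ with h | ⟨h1, h2⟩
    · obtain ⟨σ, rfl⟩ := exists_addTop π h
      exact ⟨Sum.inl ⟨σ, (goodPerm_addTop _).mp hπ⟩, rfl⟩
    · obtain ⟨σ, rfl⟩ := exists_addTwo π h1 h2
      exact ⟨Sum.inr ⟨σ, (goodPerm_addTwo _).mp hπ⟩, rfl⟩

theorem card_good_rec (n : ℕ) :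
    Nat.card {π : Equiv.Perm (Fin (n + 3)) // GoodPerm π} =
      Nat.card {π : Equiv.Perm (Fin (n + 2)) // GoodPerm π} +
        Nat.card {π : Equiv.Perm (Fin (n + 1)) // GoodPerm π} := by
  rw [← Nat.card_sum]
  exact (Nat.card_congr (Equiv.ofBijective _ (goodMap_bijective n))).symm

theorem card_good_one : Nat.card {π : Equiv.Perm (Fin 1) // GoodPerm π} = 1 := by
  simp only [GoodPerm, IsJacobi, Avoids123, Avoids213, rhoLen_eq_sum]
  rw [Nat.card_eq_fintype_card]
  decide

theorem card_good_two : Nat.card {π : Equiv.Perm (Fin 2) // GoodPerm π} = 1 := by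
  simp only [GoodPerm, IsJacobi, Avoids123, Avoids213, rhoLen_eq_sum]
  rw [Nat.card_eq_fintype_card]
  decide

/-- The number of Jacobi permutations of `[n]` avoiding both `123` and `213` is the
Fibonacci number `f (n-1)`, where `f 0 = f 1 = 1` and `f (n+2) = f (n+1) + f n`. -/
theorem jacobi_avoid_123_213_count (f : ℕ → ℕ) (hf0 : f 0 = 1) (hf1 : f 1 = 1)
    (hf : ∀ m : ℕ, f (m + 2) = f (m + 1) + f m) (n : ℕ) (hn : 1 ≤ n) :
    Nat.card {π : Equiv.Perm (Fin n) //
        IsJacobi π ∧ Avoids123 π ∧ Avoids213 π} = f (n - 1) := by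
  have main : ∀ m : ℕ, Nat.card {π : Equiv.Perm (Fin (m + 1)) // GoodPerm π} = f m ∧
      Nat.card {π : Equiv.Perm (Fin (m + 2)) // GoodPerm π} = f (m + 1) := by
    intro m
    induction m with
    | zero => exact ⟨card_good_one.trans hf0.symm, card_good_two.trans hf1.symm⟩
    | succ m ih => exact ⟨ih.2, by rw [card_good_rec, ih.1, ih.2, hf]⟩
  obtain ⟨m, rfl⟩ : ∃ m, n = m + 1 := ⟨n - 1, by omega⟩
  exact (main m).1
end
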